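/- arXiv:1404.4718 — 16 statements merged into one kernel-verified Lean document; each statement's English description precedes it below -/
import Mathlib

section
/- Consider the SCG with three players p_0, p_1, p_2 and three strategies 0, 1, 2 (indices taken mod 3), where for each j: w_{p_j}^{j} = √2, w_{p_j}^{j+1} = 1, w_{p_j}^{j+2} = 0, the only nonzero coordination weights are w(p_j, p_{j+1}) = 1, and the sharing coefficients on these pairs are γ_{p_j p_{j+1}} = 1 and γ_{p_{j+1} p_j} = 0. Then for every strategy vector s there exist a player i and a strategy k with u_i(k, s_{-i}) ≥ √2 · u_i(s) and u_i(k, s_{-i}) > u_i(s). Consequently this instance admits no α-approximate equilibrium for any 1 ≤ α < √2; in particular it has no Nash equilibrium. -/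
open Finset

/-- A social coordination game (SCG): intrinsic weights `w i k`, symmetric nonnegative
coordination weights `cw i j`, and sharing coefficients `gam i j` with
`gam i j + gam j i = 1` for distinct players. -/
structure SCG (N M : Type*) [Fintype N] [DecidableEq N] [Fintype M] [DecidableEq M] where
  w : N → M → ℝ
  cw : N → N → ℝ
  gam : N → N → ℝ
  w_nonneg : ∀ i k, 0 ≤ w i k
  cw_nonneg : ∀ i j, 0 ≤ cw i j
  cw_symm : ∀ i j, cw i j = cw j i
  gam_nonneg : ∀ i j, 0 ≤ gam i j
  gam_sum : ∀ i j, i ≠ j → gam i j + gam j i = 1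

namespace SCG

variable {N M : Type*} [Fintype N] [DecidableEq N] [Fintype M] [DecidableEq M]

/-- Player `i`'s utility under strategy vector `s`. -/
def util (G : SCG N M) (s : N → M) (i : N) : ℝ :=
  G.w i (s i) + ∑ j ∈ univ.filter (fun j => j ≠ i ∧ s j = s i), G.gam i j * G.cw i j

/-- Social welfare of a strategy vector. -/
def welfare (G : SCG N M) (s : N → M) : ℝ := ∑ i, G.util s i

/-- Pure Nash equilibrium. -/
def NashEq (G : SCG N M) (s : N → M) : Prop :=
  ∀ (i : N) (k : M), G.util (Function.update s i k) i ≤ G.util s i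

/-- `α`-approximate equilibrium. -/
def ApproxEq (G : SCG N M) (α : ℝ) (s : N → M) : Prop :=
  ∀ (i : N) (k : M), G.util (Function.update s i k) i ≤ α * G.util s i


/-- In the triangle instance, player `j` only profits from coordinating with player `j + 1`. -/
theorem util_triangle (G : SCG (Fin 3) (Fin 3))
    (hcw : ∀ j : Fin 3, G.cw j (j + 1) = 1)
    (hg1 : ∀ j : Fin 3, G.gam j (j + 1) = 1)
    (hg2 : ∀ j : Fin 3, G.gam j (j + 2) = 0) (s : Fin 3 → Fin 3) (j : Fin 3) :
    G.util s j = G.w j (s j) + if s (j + 1) = s j then 1 else 0 := by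
  have hunion : (univ : Finset (Fin 3)) = {j, j + 1, j + 2} := by
    revert j; decide
  have h01 : j ∉ ({j + 1, j + 2} : Finset (Fin 3)) := by revert j; decide
  have h12 : j + 1 ∉ ({j + 2} : Finset (Fin 3)) := by revert j; decide
  rw [util, Finset.sum_filter, hunion, Finset.sum_insert h01, Finset.sum_insert h12,
    Finset.sum_singleton, hcw, hg1, hg2]
  simp

/-- A best response of player `j` in the triangle instance when player `j + 1` plays `t`. -/
def triangleResponse (j t : Fin 3) : Fin 3 := if t = j + 1 then j + 1 else j

/-- The best responses around the triangle have no common fixed point. -/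
theorem exists_ne_triangleResponse (s : Fin 3 → Fin 3) :
    ∃ j, s j ≠ triangleResponse j (s (j + 1)) := by
  revert s; decide

/-- Utilities are nonnegative. -/
theorem util_nonneg (G : SCG N M) (s : N → M) (i : N) : 0 ≤ G.util s i :=
  add_nonneg (G.w_nonneg _ _)
    (Finset.sum_nonneg fun _ _ => mul_nonneg (G.gam_nonneg _ _) (G.cw_nonneg _ _))

/-- The three-player, three-strategy instance of Example 1 / Proposition `nonexistence`:
in every strategy vector some player can deviate and improve her utility by a factor of
at least `√2`; consequently no `α`-approximate equilibrium exists for `1 ≤ α < √2`,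
and in particular no Nash equilibrium exists. -/
theorem no_approx_equilibrium_triangle (G : SCG (Fin 3) (Fin 3))
    (hw1 : ∀ j : Fin 3, G.w j j = Real.sqrt 2)
    (hw2 : ∀ j : Fin 3, G.w j (j + 1) = 1)
    (hw3 : ∀ j : Fin 3, G.w j (j + 2) = 0)
    (hcw : ∀ j : Fin 3, G.cw j (j + 1) = 1)
    (hg1 : ∀ j : Fin 3, G.gam j (j + 1) = 1)
    (hg2 : ∀ j : Fin 3, G.gam j (j + 2) = 0) :
    (∀ s : Fin 3 → Fin 3, ∃ (i : Fin 3) (k : Fin 3),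
        Real.sqrt 2 * G.util s i ≤ G.util (Function.update s i k) i ∧
        G.util s i < G.util (Function.update s i k) i) ∧
    (∀ α : ℝ, 1 ≤ α → α < Real.sqrt 2 → ¬ ∃ s : Fin 3 → Fin 3, G.ApproxEq α s) ∧
    (¬ ∃ s : Fin 3 → Fin 3, G.NashEq s) := by
  have h2 : Real.sqrt 2 * Real.sqrt 2 = 2 := Real.mul_self_sqrt (by norm_num)
  have h1 : 1 < Real.sqrt 2 := by
    rw [Real.lt_sqrt] <;> norm_num
  have hdev : ∀ s : Fin 3 → Fin 3, ∃ (i : Fin 3) (k : Fin 3),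
      Real.sqrt 2 * G.util s i ≤ G.util (Function.update s i k) i ∧
      G.util s i < G.util (Function.update s i k) i := by
    intro s
    obtain ⟨j, hj⟩ := exists_ne_triangleResponse s
    refine ⟨j, triangleResponse j (s (j + 1)), ?_⟩
    have hne : j + 1 ≠ j := by clear hj; decide +revert
    have hne' : j + 2 ≠ j := by clear hj; decide +revert
    have hne'' : j + 2 ≠ j + 1 := by clear hj; decide +revert
    have hcases : ∀ t : Fin 3, t = j ∨ t = j + 1 ∨ t = j + 2 := by
      clear hj; decide +revert
    rw [util_triangle G hcw hg1 hg2, util_triangle G hcw hg1 hg2, Function.update_self,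
      Function.update_of_ne hne]
    rcases hcases (s j) with h | h | h <;> rcases hcases (s (j + 1)) with h' | h' | h' <;>
      simp only [triangleResponse, h, h', hw1, hw2, hw3, hne, hne', hne'', hne.symm, hne'.symm,
        hne''.symm, if_true, if_false, ne_eq, not_true_eq_false] at hj ⊢ <;>
      constructor <;> nlinarith
  have happrox : ∀ α : ℝ, 1 ≤ α → α < Real.sqrt 2 → ¬ ∃ s : Fin 3 → Fin 3, G.ApproxEq α s := by
    rintro α - hα ⟨s, hs⟩
    obtain ⟨i, k, hle, hlt⟩ := hdev s
    have hik := hs i k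
    rcases (G.util_nonneg s i).eq_or_lt with h0 | hpos
    · rw [← h0] at hik hlt
      linarith
    · linarith [mul_lt_mul_of_pos_right hα hpos]
  refine ⟨hdev, happrox, ?_⟩
  rintro ⟨s, hs⟩
  obtain ⟨i, k, -, hlt⟩ := hdev s
  exact absurd (hs i k) hlt.not_ge

end SCG
end

section
/- Suppose an SCG satisfies the Correlated Coordination condition with witnessing weights γ_i > 0. Define Φ(s) = Σ_{i∈N} w_i^{s_i}/γ_i + Σ_{unordered pairs {i,j} with s_i = s_j} w(i,j)/(γ_i + γ_j). Then Φ is an ordinal potential function: for every strategy vector s, every player i, and every strategy k, u_i(k, s_{-i}) > u_i(s) if and only if Φ(k, s_{-i}) > Φ(s). -/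
open Finset

namespace SCG

variable {N M : Type*} [Fintype N] [DecidableEq N] [Fintype M] [DecidableEq M]

/-- The ordinal potential for games satisfying the Correlated Coordination condition with
witnessing weights `γv`: `Φ(s) = Σ_i w_i^{s_i}/γ_i + Σ_{{i,j} : s_i = s_j} w(i,j)/(γ_i+γ_j)`.
The sum over unordered pairs is written as half the sum over ordered distinct pairs. -/
noncomputable def PhiCC (G : SCG N M) (γv : N → ℝ) (s : N → M) : ℝ :=
  ∑ i, G.w i (s i) / γv i +
    (1 / 2) * ∑ i, ∑ j ∈ univ.filter (fun j => j ≠ i ∧ s j = s i), G.cw i j / (γv i + γv j)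

/-- A sum over all ordered pairs of a symmetric function vanishing on the diagonal, split
according to whether a given point `i` belongs to the pair. -/
theorem sum_sum_eq_two_mul_add_erase (g : N → N → ℝ) (hsymm : ∀ a b, g a b = g b a)
    (hdiag : ∀ a, g a a = 0) (i : N) :
    ∑ a, ∑ b, g a b =
      2 * ∑ b, g i b + ∑ a ∈ univ.erase i, ∑ b ∈ univ.erase i, g a b := by
  have hrow : ∀ a, ∑ b, g a b = g a i + ∑ b ∈ univ.erase i, g a b := fun a =>
    (add_sum_erase univ (g a) (mem_univ i)).symm
  have hcol : ∑ a ∈ univ.erase i, g a i = ∑ b ∈ univ.erase i, g i b :=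
    sum_congr rfl fun a _ => hsymm a i
  rw [← add_sum_erase univ (fun a => ∑ b, g a b) (mem_univ i),
    sum_congr rfl fun a (_ : a ∈ univ.erase i) => hrow a, sum_add_distrib, hcol, hrow i, hdiag i]
  ring

/-- The part of `PhiCC` that involves player `i`. -/
noncomputable def phiCCAt (G : SCG N M) (γv : N → ℝ) (s : N → M) (i : N) : ℝ :=
  G.w i (s i) / γv i + ∑ j ∈ univ.filter (fun j => j ≠ i ∧ s j = s i), G.cw i j / (γv i + γv j)

/-- The part of `PhiCC` that does not involve player `i`. -/
noncomputable def phiCCOff (G : SCG N M) (γv : N → ℝ) (s : N → M) (i : N) : ℝ :=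
  ∑ a ∈ univ.erase i, G.w a (s a) / γv a +
    (1 / 2) * ∑ a ∈ univ.erase i, ∑ b ∈ univ.erase i,
      if b ≠ a ∧ s b = s a then G.cw a b / (γv a + γv b) else 0

theorem PhiCC_eq_phiCCAt_add_phiCCOff (G : SCG N M) (γv : N → ℝ) (s : N → M) (i : N) :
    G.PhiCC γv s = G.phiCCAt γv s i + G.phiCCOff γv s i := by
  have hpairs := sum_sum_eq_two_mul_add_erase
    (fun a b => if b ≠ a ∧ s b = s a then G.cw a b / (γv a + γv b) else 0)
    (fun a b => by simp only [ne_comm (a := a), eq_comm (a := s a), G.cw_symm a b, add_comm (γv a)])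
    (fun a => by simp) i
  simp only [PhiCC, phiCCAt, phiCCOff, sum_filter]
  rw [hpairs, ← add_sum_erase univ (fun a => G.w a (s a) / γv a) (mem_univ i)]
  ring

theorem phiCCOff_update (G : SCG N M) (γv : N → ℝ) (s : N → M) (i : N) (k : M) :
    G.phiCCOff γv (Function.update s i k) i = G.phiCCOff γv s i := by
  have hoff : ∀ a ∈ univ.erase i, Function.update s i k a = s a := fun a ha =>
    Function.update_of_ne (ne_of_mem_erase ha) _ _
  unfold phiCCOff
  congr 1
  · exact sum_congr rfl fun a ha => by rw [hoff a ha]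
  · congr 1
    exact sum_congr rfl fun a ha => sum_congr rfl fun b hb => by rw [hoff a ha, hoff b hb]

theorem util_eq_mul_phiCCAt (G : SCG N M) (γv : N → ℝ) (hpos : ∀ i, 0 < γv i)
    (hcc : ∀ i j : N, i ≠ j → 0 < G.cw i j → G.gam i j = γv i / (γv i + γv j))
    (s : N → M) (i : N) :
    G.util s i = γv i * G.phiCCAt γv s i := by
  rw [util, phiCCAt, mul_add, mul_div_cancel₀ _ (hpos i).ne', mul_sum]
  congr 1
  refine sum_congr rfl fun j hj => ?_
  rcases (G.cw_nonneg i j).eq_or_lt with h | h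
  · simp [← h]
  · rw [hcc i j (mem_filter.mp hj).2.1.symm h]
    ring

/-- `PhiCC` is an ordinal potential function for SCGs satisfying the Correlated
Coordination condition. -/
theorem phiCC_ordinal_potential (G : SCG N M) (γv : N → ℝ)
    (hpos : ∀ i, 0 < γv i)
    (hcc : ∀ i j : N, i ≠ j → 0 < G.cw i j → G.gam i j = γv i / (γv i + γv j)) :
    ∀ (s : N → M) (i : N) (k : M),
      G.util s i < G.util (Function.update s i k) i ↔
      G.PhiCC γv s < G.PhiCC γv (Function.update s i k) := by
  intro s i k
  rw [G.util_eq_mul_phiCCAt γv hpos hcc, G.util_eq_mul_phiCCAt γv hpos hcc,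
    mul_lt_mul_iff_right₀ (hpos i), G.PhiCC_eq_phiCCAt_add_phiCCOff γv s i,
    G.PhiCC_eq_phiCCAt_add_phiCCOff γv (Function.update s i k) i, phiCCOff_update,
    add_lt_add_iff_right]

end SCG
end

section
/- Every SCG satisfying the Correlated Coordination condition possesses a pure Nash equilibrium, i.e., a strategy vector s such that u_i(s) ≥ u_i(k, s_{-i}) for every player i and every strategy k. -/
open Finset

namespace SCG

variable {N M : Type*} [Fintype N] [DecidableEq N] [Fintype M] [DecidableEq M]

/-- Utility of player `i` in the rescaled game with intrinsic weights `a` and coordination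
benefits `c`. -/
def scaledUtil (a : N → M → ℝ) (c : N → N → ℝ) (s : N → M) (i : N) : ℝ :=
  a i (s i) + ∑ j ∈ univ.erase i, if s j = s i then c i j else 0

/-- Twice the exact potential of the rescaled game. -/
def potential (a : N → M → ℝ) (c : N → N → ℝ) (s : N → M) : ℝ :=
  ∑ i, (a i (s i) + scaledUtil a c s i)

/-- The part of the potential that does not involve player `i`. -/
def potentialRest (a : N → M → ℝ) (c : N → N → ℝ) (s : N → M) (i : N) : ℝ :=
  ∑ p ∈ univ.erase i,
    (2 * a p (s p) + ∑ q ∈ (univ.erase p).erase i, if s q = s p then c p q else 0)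

theorem potential_eq (a : N → M → ℝ) (c : N → N → ℝ) (hc : ∀ i j, c i j = c j i)
    (s : N → M) (i : N) :
    potential a c s = 2 * scaledUtil a c s i + potentialRest a c s i := by
  have hp : ∀ p ∈ univ.erase i, a p (s p) + scaledUtil a c s p =
      (if s p = s i then c i p else 0) +
        (2 * a p (s p) + ∑ q ∈ (univ.erase p).erase i, if s q = s p then c p q else 0) := by
    intro p hp
    have hi : i ∈ univ.erase p := by simpa [eq_comm] using hp
    rw [scaledUtil, ← add_sum_erase _ _ hi, hc p i]
    simp only [eq_comm (a := s i) (b := s p)]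
    ring
  rw [potential, ← add_sum_erase _ _ (mem_univ i), sum_congr rfl hp, sum_add_distrib,
    potentialRest, scaledUtil]
  ring

theorem potentialRest_update (a : N → M → ℝ) (c : N → N → ℝ) (s : N → M) (i : N) (k : M) :
    potentialRest a c (Function.update s i k) i = potentialRest a c s i := by
  refine sum_congr rfl fun p hp => ?_
  rw [Function.update_of_ne (ne_of_mem_erase hp)]
  congr 1
  refine sum_congr rfl fun q hq => ?_
  rw [Function.update_of_ne (ne_of_mem_erase hq)]

/-- Correlated sharing makes each utility a positive multiple of a symmetric one. -/
theorem util_eq_mul_scaledUtil (G : SCG N M) (γv : N → ℝ) (hpos : ∀ i, 0 < γv i)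
    (hγ : ∀ i j : N, i ≠ j → 0 < G.cw i j → G.gam i j = γv i / (γv i + γv j))
    (s : N → M) (i : N) :
    G.util s i = γv i * scaledUtil (fun i k => G.w i k / γv i)
      (fun i j => G.cw i j / (γv i + γv j)) s i := by
  rw [util, scaledUtil, mul_add, mul_div_cancel₀ _ (hpos i).ne', mul_sum, ← filter_filter,
    filter_ne', sum_filter]
  congr 1
  refine sum_congr rfl fun j hj => ?_
  rw [mul_ite, mul_zero]
  congr 1
  rcases (G.cw_nonneg i j).eq_or_lt with h | h
  · simp [← h]
  · rw [hγ i j (ne_of_mem_erase hj).symm h]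
    ring

/-- Every SCG satisfying the Correlated Coordination condition possesses a pure
Nash equilibrium. -/
theorem cc_exists_nash [Nonempty N] [Nonempty M] (G : SCG N M)
    (hcc : ∃ γv : N → ℝ, (∀ i, 0 < γv i) ∧
      ∀ i j : N, i ≠ j → 0 < G.cw i j → G.gam i j = γv i / (γv i + γv j)) :
    ∃ s : N → M, G.NashEq s := by
  obtain ⟨γv, hpos, hγ⟩ := hcc
  let a : N → M → ℝ := fun i k => G.w i k / γv i
  let c : N → N → ℝ := fun i j => G.cw i j / (γv i + γv j)
  have hc : ∀ i j, c i j = c j i := fun i j => by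
    simp only [c, G.cw_symm i j, add_comm (γv i)]
  obtain ⟨s, hs⟩ := Finite.exists_max (potential a c)
  refine ⟨s, fun i k => ?_⟩
  have h := hs (Function.update s i k)
  rw [potential_eq a c hc _ i, potential_eq a c hc s i, potentialRest_update] at h
  rw [util_eq_mul_scaledUtil G γv hpos hγ, util_eq_mul_scaledUtil G γv hpos hγ]
  exact mul_le_mul_of_nonneg_left (by linarith) (hpos i).le

end SCG
end

section
/- (Price of Anarchy at most m) If s is a Nash equilibrium of an SCG with m strategies, then m·u(s) ≥ u(s') for every strategy vector s'. -/
open Finset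

namespace SCG

variable {N M : Type*} [Fintype N] [DecidableEq N] [Fintype M] [DecidableEq M]

/-- Summed over all unilateral deviations of player `i`, the utilities collect every intrinsic
weight of `i` and `i`'s share of every coordination weight. -/
theorem sum_util_update (G : SCG N M) (s : N → M) (i : N) :
    ∑ k, G.util (Function.update s i k) i =
      ∑ k, G.w i k + ∑ j ∈ univ.filter (fun j => j ≠ i), G.gam i j * G.cw i j := by
  simp only [util, sum_add_distrib, Function.update_self, ← filter_filter]
  congr 1
  simp_rw [sum_filter (fun j => Function.update s i _ j = _)]
  rw [sum_comm]
  refine sum_congr rfl fun j hj => ?_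
  simp [Function.update_of_ne (mem_filter.mp hj).2]

/-- The utility of player `i` under any strategy vector is at most the sum of the utilities of
all unilateral deviations of `i` from any other strategy vector. -/
theorem util_le_sum_util_update (G : SCG N M) (s s' : N → M) (i : N) :
    G.util s' i ≤ ∑ k, G.util (Function.update s i k) i := by
  rw [sum_util_update]
  refine add_le_add (single_le_sum (fun k _ => G.w_nonneg i k) (mem_univ (s' i))) ?_
  refine sum_le_sum_of_subset_of_nonneg (fun j hj => ?_)
    fun j _ _ => mul_nonneg (G.gam_nonneg i j) (G.cw_nonneg i j)
  exact mem_filter.mpr ⟨mem_univ j, (mem_filter.mp hj).2.1⟩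

/-- Price of Anarchy at most `m`: any Nash equilibrium has social welfare at least a
fraction `1/m` of that of any strategy vector. -/
theorem poa_le_card (G : SCG N M) (s : N → M) (hs : G.NashEq s) :
    ∀ s' : N → M, G.welfare s' ≤ (Fintype.card M : ℝ) * G.welfare s := by
  intro s'
  rw [welfare, welfare, mul_sum]
  refine sum_le_sum fun i _ => (G.util_le_sum_util_update s s' i).trans ?_
  simpa using sum_le_sum (s := univ) fun k _ => hs i k

end SCG
end

section
/- (Price of Stability at least m) For every integer m ≥ 2 and every real δ > 0, there exists an SCG with m strategies that has at least one Nash equilibrium and in which every Nash equilibrium s satisfies max_{s'} u(s') > (m − δ)·u(s), where the maximum is over all strategy vectors s'. -/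
open Finset

namespace SCG

variable {N M : Type*} [Fintype N] [DecidableEq N] [Fintype M] [DecidableEq M]

section CyclicGame

/-- The game in which player `i` receives the full unit coordination weight from each
predecessor and has intrinsic weight `2` for the strategy `i mod m` only. -/
def cyclicGame (n m : ℕ) [NeZero m] : SCG (Fin n) (Fin m) where
  w i k := if k = Fin.ofNat m i then 2 else 0
  cw _ _ := 1
  gam i j := if j < i then 1 else 0
  w_nonneg i k := by split_ifs <;> norm_num
  cw_nonneg _ _ := zero_le_one
  cw_symm _ _ := rfl
  gam_nonneg i j := by split_ifs <;> norm_num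
  gam_sum i j h := by
    rcases lt_or_gt_of_ne h with h | h <;> simp [h, h.not_gt]

/-- The strategy vector assigning the strategies cyclically. -/
def cyclicProfile (n m : ℕ) [NeZero m] : Fin n → Fin m := fun i => Fin.ofNat m i

variable {n m : ℕ} [NeZero m]

theorem util_cyclicGame (s : Fin n → Fin m) (i : Fin n) :
    (cyclicGame n m).util s i =
      (if s i = Fin.ofNat m i then 2 else 0) + (#{j | j < i ∧ s j = s i} : ℝ) := by
  simp only [util, cyclicGame, mul_one, sum_boole, filter_filter]
  congr 3
  ext j
  simp only [mem_filter, mem_univ, true_and]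
  exact ⟨fun h => ⟨h.2, h.1.2⟩, fun h => ⟨⟨h.1.ne, h.2⟩, h.1⟩⟩

theorem card_predecessors_cyclicProfile (i : Fin n) (k : Fin m) :
    #{j | j < i ∧ cyclicProfile n m j = k} =
      (i : ℕ) / m + if (k : ℕ) < i % m then 1 else 0 := by
  have h := Nat.count_modEq_card (i : ℕ) (NeZero.pos m) (k : ℕ)
  rw [Nat.mod_eq_of_lt k.isLt] at h
  rw [← h, Nat.count_eq_card_filter_range]
  refine card_bij (fun j _ => (j : ℕ)) ?_ (fun _ _ _ _ h => Fin.ext h) ?_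
  · intro j hj
    simpa [cyclicProfile, Fin.ext_iff, Nat.ModEq, Nat.mod_eq_of_lt k.isLt] using hj
  · intro j hj
    simp only [mem_filter, mem_range, Nat.ModEq, Nat.mod_eq_of_lt k.isLt] at hj
    exact ⟨⟨j, hj.1.trans i.isLt⟩, mem_filter.2 ⟨mem_univ _, hj.1, Fin.ext hj.2⟩, rfl⟩

theorem util_cyclicGame_update {s : Fin n → Fin m} {i : Fin n}
    (hs : ∀ j < i, s j = cyclicProfile n m j) (k : Fin m) :
    (cyclicGame n m).util (Function.update s i k) i =
      (if k = cyclicProfile n m i then 2 else 0) +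
        (((i : ℕ) / m + if (k : ℕ) < i % m then 1 else 0 : ℕ) : ℝ) := by
  rw [util_cyclicGame, ← card_predecessors_cyclicProfile]
  have hset : ∀ j, (j < i ∧ Function.update s i k j = k) ↔ j < i ∧ cyclicProfile n m j = k :=
    fun j => and_congr_right fun h => by rw [Function.update_of_ne h.ne, hs j h]
  simp only [Function.update_self, hset]
  rfl

theorem util_cyclicGame_update_cyclicProfile {s : Fin n → Fin m} {i : Fin n}
    (hs : ∀ j < i, s j = cyclicProfile n m j) :
    (cyclicGame n m).util (Function.update s i (cyclicProfile n m i)) i =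
      2 + (((i : ℕ) / m : ℕ) : ℝ) := by
  rw [util_cyclicGame_update hs]
  simp [cyclicProfile]

theorem util_cyclicGame_update_le {s : Fin n → Fin m} {i : Fin n}
    (hs : ∀ j < i, s j = cyclicProfile n m j) {k : Fin m} (hk : k ≠ cyclicProfile n m i) :
    (cyclicGame n m).util (Function.update s i k) i ≤ 1 + (((i : ℕ) / m : ℕ) : ℝ) := by
  rw [util_cyclicGame_update hs, if_neg hk]
  split_ifs <;> push_cast <;> linarith

theorem util_cyclicProfile (i : Fin n) :
    (cyclicGame n m).util (cyclicProfile n m) i = 2 + (((i : ℕ) / m : ℕ) : ℝ) := by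
  simpa using util_cyclicGame_update_cyclicProfile (m := m) (i := i) fun _ _ => rfl

theorem nashEq_cyclicProfile : (cyclicGame n m).NashEq (cyclicProfile n m) := by
  intro i k
  by_cases hk : k = cyclicProfile n m i
  · simp [hk]
  · rw [util_cyclicProfile]
    linarith [util_cyclicGame_update_le (fun _ _ => rfl) hk]

theorem NashEq.eq_cyclicProfile {s : Fin n → Fin m} (h : (cyclicGame n m).NashEq s) :
    s = cyclicProfile n m := by
  funext i
  induction i using WellFoundedLT.induction with
  | ind i ih =>
    by_contra hk
    have hle := util_cyclicGame_update_le ih hk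
    rw [Function.update_eq_self] at hle
    linarith [h i (cyclicProfile n m i), util_cyclicGame_update_cyclicProfile ih]

theorem sum_fin_val_cast (n : ℕ) : ∑ i : Fin n, ((i : ℕ) : ℝ) = n * (n - 1) / 2 := by
  rw [Fin.sum_univ_eq_sum_range (fun i => (i : ℝ)) n]
  induction n with
  | zero => simp
  | succ n ih => rw [sum_range_succ, ih]; push_cast; ring

theorem welfare_cyclicProfile_le :
    (cyclicGame n m).welfare (cyclicProfile n m) ≤ 2 * n + n * (n - 1) / 2 / m := by
  calc (cyclicGame n m).welfare (cyclicProfile n m)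
      ≤ ∑ i : Fin n, (2 + ((i : ℕ) : ℝ) / m) :=
        sum_le_sum fun i _ => by
          rw [util_cyclicProfile]
          gcongr
          exact Nat.cast_div_le
    _ = 2 * n + n * (n - 1) / 2 / m := by
        rw [sum_add_distrib, ← sum_div, sum_fin_val_cast]
        simp [mul_comm]

theorem le_welfare_const (k : Fin m) :
    (n * (n - 1) / 2 : ℝ) ≤ (cyclicGame n m).welfare fun _ => k := by
  rw [← sum_fin_val_cast]
  refine sum_le_sum fun i _ => ?_
  rw [util_cyclicGame]
  have hcard : #{j : Fin n | j < i} = (i : ℕ) := by rw [filter_gt_eq_Iio, Fin.card_Iio]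
  simp only [and_true, hcard]
  split_ifs <;> linarith

theorem welfare_nonneg (G : SCG N M) (s : N → M) : 0 ≤ G.welfare s :=
  sum_nonneg fun i _ => add_nonneg (G.w_nonneg _ _) <|
    sum_nonneg fun j _ => mul_nonneg (G.gam_nonneg i j) (G.cw_nonneg i j)

end CyclicGame

/-- Price of Stability at least `m`: for every `m ≥ 2` and `δ > 0` there is an SCG with
`m` strategies admitting a Nash equilibrium, in which every Nash equilibrium `s` has
social welfare smaller than a fraction `1/(m-δ)` of the optimum welfare. -/
theorem pos_lower_bound (m : ℕ) (hm : 2 ≤ m) (δ : ℝ) (hδ : 0 < δ) :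
    ∃ (n : ℕ) (_ : 0 < n) (G : SCG (Fin n) (Fin m)),
      (∃ s : Fin n → Fin m, G.NashEq s) ∧
      ∀ s : Fin n → Fin m, G.NashEq s →
        ∃ s' : Fin n → Fin m, ((m : ℝ) - δ) * G.welfare s < G.welfare s' := by
  have : NeZero m := ⟨by omega⟩
  have hm0 : (0 : ℝ) < m := Nat.cast_pos.2 (NeZero.pos m)
  obtain ⟨q, hq⟩ := exists_nat_gt (4 * (m : ℝ) ^ 2 / δ)
  have hq0 : (0 : ℝ) < q := lt_of_le_of_lt (by positivity) hq
  rw [div_lt_iff₀ hδ] at hq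
  refine ⟨q + 1, q.succ_pos, cyclicGame (q + 1) m, ⟨_, nashEq_cyclicProfile⟩, fun s hs => ?_⟩
  refine ⟨fun _ => 0, lt_of_lt_of_le ?_ (le_welfare_const 0)⟩
  rw [hs.eq_cyclicProfile]
  have hle := welfare_cyclicProfile_le (n := q + 1) (m := m)
  push_cast at hle ⊢
  rw [add_sub_cancel_right] at hle ⊢
  rcases le_total (m : ℝ) δ with h | h
  · refine lt_of_le_of_lt (mul_nonpos_of_nonpos_of_nonneg (sub_nonpos.2 h) (welfare_nonneg _ _)) ?_
    positivity
  · refine (mul_le_mul_of_nonneg_left hle (sub_nonneg.2 h)).trans_lt ?_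
    have key : (m - δ) * (4 * m + q) < q * m := by nlinarith
    have hfac : (m - δ) * (2 * ((q : ℝ) + 1) + (q + 1) * q / 2 / m) =
        (q + 1) / (2 * m) * ((m - δ) * (4 * m + q)) := by
      field_simp
      ring
    have hopt : ((q : ℝ) + 1) * q / 2 = (q + 1) / (2 * m) * (q * m) := by
      field_simp
    rw [hfac, hopt]
    gcongr

end SCG
end

section
/- For a symmetric SCG with m strategies, define Φ(s) = Σ_{i∈N} w_i^{s_i} + (1/2)·Σ_{unordered pairs {i,j} with s_i = s_j} w(i,j) and A(s) = Σ_{i∈N} w_i^{s_i}. If strategy vectors s and s_0 satisfy Φ(s) ≥ Φ(s_0) and m·A(s_0) ≥ A(s), then (2 − 1/m)·u(s) ≥ u(s_0). -/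
open Finset

namespace SCG

variable {N M : Type*} [Fintype N] [DecidableEq N] [Fintype M] [DecidableEq M]

/-- The potential `Φ(s) = Σ_i w_i^{s_i} + (1/2)·Σ_{unordered pairs {i,j} : s_i = s_j} w(i,j)`
for symmetric SCGs.  The sum over unordered pairs is written as half the sum over
ordered distinct pairs. -/
noncomputable def Phi (G : SCG N M) (s : N → M) : ℝ :=
  ∑ i, G.w i (s i) +
    (1 / 2) * ((1 / 2) * ∑ i, ∑ j ∈ univ.filter (fun j => j ≠ i ∧ s j = s i), G.cw i j)

/-- The intrinsic-preference part `A(s) = Σ_i w_i^{s_i}` of the social welfare. -/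
def intrinsic (G : SCG N M) (s : N → M) : ℝ := ∑ i, G.w i (s i)

/-- The coordination part of the social welfare of a symmetric SCG. -/
noncomputable def coordination (G : SCG N M) (s : N → M) : ℝ :=
  (1 / 2) * ∑ i, ∑ j ∈ univ.filter (fun j => j ≠ i ∧ s j = s i), G.cw i j

theorem coordination_nonneg (G : SCG N M) (s : N → M) : 0 ≤ G.coordination s :=
  mul_nonneg (by norm_num)
    (sum_nonneg fun i _ => sum_nonneg fun j _ => G.cw_nonneg i j)

theorem Phi_eq_intrinsic_add_coordination (G : SCG N M) (s : N → M) :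
    G.Phi s = G.intrinsic s + (1 / 2) * G.coordination s := rfl

theorem welfare_eq_intrinsic_add_coordination (G : SCG N M)
    (hsym : ∀ i j : N, i ≠ j → G.gam i j = 1 / 2) (s : N → M) :
    G.welfare s = G.intrinsic s + G.coordination s := by
  simp only [welfare, util, intrinsic, coordination, sum_add_distrib, mul_sum]
  congr 1
  refine sum_congr rfl fun i _ => sum_congr rfl fun j hj => ?_
  rw [hsym i j (mem_filter.mp hj).2.1.symm]

/-- In a symmetric SCG, if `Φ(s) ≥ Φ(s₀)` and `m·A(s₀) ≥ A(s)` then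
`(2 - 1/m)·u(s) ≥ u(s₀)`. -/
theorem welfare_from_good_start [Nonempty M] (G : SCG N M)
    (hsym : ∀ i j : N, i ≠ j → G.gam i j = 1 / 2)
    (s s₀ : N → M)
    (hPhi : G.Phi s₀ ≤ G.Phi s)
    (hA : G.intrinsic s ≤ (Fintype.card M : ℝ) * G.intrinsic s₀) :
    G.welfare s₀ ≤ (2 - 1 / (Fintype.card M : ℝ)) * G.welfare s := by
  have hm : (1 : ℝ) ≤ Fintype.card M := by exact_mod_cast Fintype.card_pos (α := M)
  have hinv : 1 / (Fintype.card M : ℝ) ≤ 1 := div_le_one_of_le₀ hm (by linarith)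
  have hA' : 1 / (Fintype.card M : ℝ) * G.intrinsic s ≤ G.intrinsic s₀ := by
    rw [one_div, inv_mul_le_iff₀ (by linarith)]
    exact hA
  have hC := mul_nonneg (sub_nonneg.mpr hinv) (G.coordination_nonneg s)
  rw [Phi_eq_intrinsic_add_coordination, Phi_eq_intrinsic_add_coordination] at hPhi
  rw [G.welfare_eq_intrinsic_add_coordination hsym, G.welfare_eq_intrinsic_add_coordination hsym]
  linarith

end SCG
end

section
/- (Optimum satisfies the Minimum Intrinsic Preference condition) If s* is a welfare-maximizing strategy vector of an SCG with m strategies (u(s*) ≥ u(s) for all strategy vectors s), then m·Σ_{i∈N} w_i^{s*_i} ≥ Σ_{i∈N} max_{k∈M} w_i^k. -/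
open Finset

namespace SCG

variable {N M : Type*} [Fintype N] [DecidableEq N] [Fintype M] [DecidableEq M]

/-- When every player uses the same strategy `k`, each player receives at least the coordination
utility they receive under any other strategy vector. -/
theorem util_sub_le_util_const (G : SCG N M) (s : N → M) (k : M) (i : N) :
    G.util s i - G.w i (s i) ≤ G.util (fun _ => k) i - G.w i k := by
  simp only [util, add_sub_cancel_left]
  refine sum_le_sum_of_subset_of_nonneg ?_
    fun j _ _ => mul_nonneg (G.gam_nonneg i j) (G.cw_nonneg i j)
  intro j hj
  simp only [mem_filter, mem_univ, true_and, and_true] at hj ⊢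
  exact hj.1

/-- The intrinsic welfare of an optimum is at least that of any constant strategy vector. -/
theorem sum_w_le_sum_w_of_forall_welfare_le (G : SCG N M) {s : N → M}
    (hs : ∀ t : N → M, G.welfare t ≤ G.welfare s) (k : M) :
    ∑ i, G.w i k ≤ ∑ i, G.w i (s i) := by
  have h := sum_le_sum fun i (_ : i ∈ univ) => G.util_sub_le_util_const s k i
  simp only [sum_sub_distrib] at h
  have hk := hs fun _ => k
  simp only [welfare] at hk
  linarith

/-- The optimum satisfies the Minimum Intrinsic Preference condition:
`m·Σ_i w_i^{s*_i} ≥ Σ_i max_k w_i^k` for any welfare-maximizing `s*`. -/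
theorem optimum_mip [Nonempty M] (G : SCG N M) (sstar : N → M)
    (hopt : ∀ s : N → M, G.welfare s ≤ G.welfare sstar) :
    (∑ i, univ.sup' univ_nonempty (G.w i)) ≤
      (Fintype.card M : ℝ) * ∑ i, G.w i (sstar i) := by
  calc
    ∑ i, univ.sup' univ_nonempty (G.w i) ≤ ∑ i, ∑ k, G.w i k :=
      sum_le_sum fun i _ => sup'_le _ _ fun k hk =>
        single_le_sum (fun l _ => G.w_nonneg i l) hk
    _ = ∑ k, ∑ i, G.w i k := sum_comm
    _ ≤ ∑ _k : M, ∑ i, G.w i (sstar i) :=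
      sum_le_sum fun k _ => G.sum_w_le_sum_w_of_forall_welfare_le hopt k
    _ = (Fintype.card M : ℝ) * ∑ i, G.w i (sstar i) := by
      rw [sum_const, card_univ, nsmul_eq_mul]

end SCG
end

section
/- Every SCG with exactly 3 strategies admits a √2-approximate equilibrium, i.e., a strategy vector s such that √2·u_i(s) ≥ u_i(k, s_{-i}) for every player i and every strategy k. -/
open Finset

namespace SCG

variable {N M : Type*} [Fintype N] [DecidableEq N] [Fintype M] [DecidableEq M]

/-- The utility of player `i` for strategy `k` when the other players using `k` are those in `X`. -/
noncomputable def utilAgainst (G : SCG N M) (X : Set N) (i : N) (k : M) : ℝ :=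
  G.w i k + ∑ j, (X \ {i}).indicator (fun j => G.gam i j * G.cw i j) j

lemma util_update (G : SCG N M) (s : N → M) (i : N) (k : M) :
    G.util (Function.update s i k) i = G.utilAgainst {j | s j = k} i k := by
  unfold util utilAgainst
  rw [Function.update_self, Finset.sum_filter]
  congr 1
  refine Finset.sum_congr rfl fun j _ => ?_
  by_cases hj : j = i
  · simp [hj]
  · simp [Set.indicator_apply, hj]

lemma util_eq_utilAgainst (G : SCG N M) (s : N → M) (i : N) :
    G.util s i = G.utilAgainst {j | s j = s i} i (s i) := by
  rw [← util_update, Function.update_eq_self]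

lemma utilAgainst_nonneg (G : SCG N M) (X : Set N) (i : N) (k : M) :
    0 ≤ G.utilAgainst X i k :=
  add_nonneg (G.w_nonneg i k) (Finset.sum_nonneg fun j _ =>
    Set.indicator_nonneg (fun j _ => mul_nonneg (G.gam_nonneg i j) (G.cw_nonneg i j)) j)

lemma utilAgainst_mono (G : SCG N M) {X Y : Set N} (h : X ⊆ Y) (i : N) (k : M) :
    G.utilAgainst X i k ≤ G.utilAgainst Y i k :=
  add_le_add le_rfl (Finset.sum_le_sum fun j _ =>
    Set.indicator_le_indicator_of_subset (Set.sdiff_subset_sdiff_left h)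
      (fun j => mul_nonneg (G.gam_nonneg i j) (G.cw_nonneg i j)) j)

lemma utilAgainst_union_le_left (G : SCG N M) (X Y : Set N) (i : N) (k l : M) :
    G.utilAgainst (X ∪ Y) i k ≤ G.utilAgainst X i k + G.utilAgainst Y i l := by
  unfold utilAgainst
  have hsum : ∑ j, ((X ∪ Y) \ {i}).indicator (fun j => G.gam i j * G.cw i j) j ≤
      ∑ j, (X \ {i}).indicator (fun j => G.gam i j * G.cw i j) j +
      ∑ j, (Y \ {i}).indicator (fun j => G.gam i j * G.cw i j) j := by
    rw [← Finset.sum_add_distrib]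
    refine Finset.sum_le_sum fun j _ => ?_
    have := mul_nonneg (G.gam_nonneg i j) (G.cw_nonneg i j)
    by_cases hi : j = i <;> by_cases hX : j ∈ X <;> by_cases hY : j ∈ Y <;>
      simp [hi, hX, hY, this]
  linarith [G.w_nonneg i l]

lemma utilAgainst_union_le_right (G : SCG N M) (X Y : Set N) (i : N) (k l : M) :
    G.utilAgainst (X ∪ Y) i l ≤ G.utilAgainst X i k + G.utilAgainst Y i l := by
  rw [Set.union_comm, add_comm]
  exact G.utilAgainst_union_le_left Y X i l k

/-- Some set `T` consists exactly of the players for whom strategy `c` with partners `T` is, up to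
the factor `α`, at least as good as `a` or `b` with all of `Tᶜ` as partners. -/
lemma exists_set_mem_iff (G : SCG N M) {α : ℝ} (hα : 0 ≤ α) (a b c : M) :
    ∃ T : Set N, ∀ i, i ∈ T ↔ G.utilAgainst Tᶜ i a ≤ α * G.utilAgainst T i c ∧
      G.utilAgainst Tᶜ i b ≤ α * G.utilAgainst T i c := by
  let Φ : Set N →o Set N :=
    { toFun := fun T => {i | G.utilAgainst Tᶜ i a ≤ α * G.utilAgainst T i c ∧
        G.utilAgainst Tᶜ i b ≤ α * G.utilAgainst T i c}
      monotone' := fun X Y hXY i hi => by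
        have hc := mul_le_mul_of_nonneg_left (G.utilAgainst_mono hXY i c) hα
        have hXY' : Yᶜ ⊆ Xᶜ := Set.compl_subset_compl.2 hXY
        exact ⟨(G.utilAgainst_mono hXY' i a).trans (hi.1.trans hc),
          (G.utilAgainst_mono hXY' i b).trans (hi.2.trans hc)⟩ }
  refine ⟨Φ.lfp, fun i => ?_⟩
  conv_lhs => rw [← Φ.map_lfp]
  rfl

/-- The game restricted to the players in `P` and to the strategies `a` and `b` has a pure Nash
equilibrium, in which `S` is the set of players using `a`. -/
lemma exists_subset_mem_iff (G : SCG N M) (P : Set N) (a b : M) :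
    ∃ S ⊆ P, ∀ i ∈ P, i ∈ S ↔ G.utilAgainst (P \ S) i b ≤ G.utilAgainst S i a := by
  let Ψ : Set N →o Set N :=
    { toFun := fun S => {i | i ∈ P ∧ G.utilAgainst (P \ S) i b ≤ G.utilAgainst S i a}
      monotone' := fun X Y hXY i hi =>
        ⟨hi.1, (G.utilAgainst_mono (Set.sdiff_subset_sdiff_right hXY) i b).trans
          (hi.2.trans (G.utilAgainst_mono hXY i a))⟩ }
  have h (i : N) : i ∈ Ψ.lfp ↔
      i ∈ P ∧ G.utilAgainst (P \ Ψ.lfp) i b ≤ G.utilAgainst Ψ.lfp i a := by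
    conv_lhs => rw [← Ψ.map_lfp]
    rfl
  exact ⟨Ψ.lfp, fun i hi => ((h i).1 hi).1, fun i hi => by rw [h i]; exact and_iff_right hi⟩

/-- Every SCG with exactly three strategies admits a `√2`-approximate equilibrium. -/
theorem exists_sqrt_two_approx [Nonempty N] (G : SCG N M) (hM : Fintype.card M = 3) :
    ∃ s : N → M, G.ApproxEq (Real.sqrt 2) s := by
  classical
  obtain ⟨a, b, c, hab, hac, hbc, huniv⟩ := Finset.card_eq_three.1 (Finset.card_univ.trans hM)
  have hα : 1 ≤ √(2 : ℝ) := Real.one_le_sqrt.2 one_le_two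
  have hαα : √(2 : ℝ) * √2 = 2 := Real.mul_self_sqrt zero_le_two
  obtain ⟨T, hT⟩ := G.exists_set_mem_iff (zero_le_one.trans hα) a b c
  obtain ⟨S, hST, hS⟩ := G.exists_subset_mem_iff Tᶜ a b
  let s : N → M := fun i => if i ∈ T then c else if i ∈ S then a else b
  have hsT (i : N) (hi : i ∈ T) : s i = c := if_pos hi
  have hsS (i : N) (hi : i ∈ S) : s i = a := by simp [s, hi, show i ∉ T from hST hi]
  have hsR (i : N) (hiT : i ∉ T) (hiS : i ∉ S) : s i = b := by simp [s, hiT, hiS]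
  have hc : {j | s j = c} = T := by
    ext j
    by_cases hjT : j ∈ T <;> by_cases hjS : j ∈ S <;> simp [s, hjT, hjS, hac, hbc]
  have ha : {j | s j = a} = S := by
    ext j
    by_cases hjS : j ∈ S
    · simp [hsS j hjS, hjS]
    · by_cases hjT : j ∈ T <;> simp [s, hjT, hjS, hac.symm, hab.symm]
  have hb : {j | s j = b} = Tᶜ \ S := by
    ext j
    by_cases hjT : j ∈ T <;> by_cases hjS : j ∈ S <;> simp [s, hjT, hjS, hab, hbc.symm]
  -- A player outside `T` using the better of `a`, `b` does not gain more than `√2` by moving to `c`.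
  have hout (i : N) (hi : i ∉ T) (u : ℝ) (hua : G.utilAgainst S i a ≤ u)
      (hub : G.utilAgainst (Tᶜ \ S) i b ≤ u) : G.utilAgainst T i c ≤ √2 * u := by
    have hl := G.utilAgainst_union_le_left S (Tᶜ \ S) i a b
    have hr := G.utilAgainst_union_le_right S (Tᶜ \ S) i a b
    rw [Set.union_sdiff_cancel hST] at hl hr
    have hlt : √2 * G.utilAgainst T i c ≤ 2 * u := by
      by_contra! h
      exact hi ((hT i).2 ⟨by linarith, by linarith⟩)
    have h2 := mul_le_mul_of_nonneg_left hlt (zero_le_one.trans hα)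
    rw [← mul_assoc, hαα] at h2
    linarith
  have hle (x : ℝ) (hx : 0 ≤ x) : x ≤ √2 * x := le_mul_of_one_le_left hx hα
  refine ⟨s, fun i k => ?_⟩
  rw [util_update, util_eq_utilAgainst]
  have hk : k = a ∨ k = b ∨ k = c := by
    have := Finset.mem_univ k
    rw [huniv] at this
    simpa using this
  by_cases hiT : i ∈ T
  · obtain ⟨h1, h2⟩ := (hT i).1 hiT
    rw [hsT i hiT, hc]
    rcases hk with rfl | rfl | rfl
    · exact ha ▸ (G.utilAgainst_mono hST i _).trans h1
    · exact hb ▸ (G.utilAgainst_mono Set.sdiff_subset i _).trans h2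
    · exact hc ▸ hle _ (G.utilAgainst_nonneg _ _ _)
  by_cases hiS : i ∈ S
  · have h := (hS i hiT).1 hiS
    have hu := hle _ (G.utilAgainst_nonneg S i a)
    rw [hsS i hiS, ha]
    rcases hk with rfl | rfl | rfl
    · rwa [ha]
    · exact hb ▸ h.trans hu
    · exact hc ▸ hout i hiT _ le_rfl h
  · have h := (lt_of_not_ge (mt (hS i hiT).2 hiS)).le
    have hu := hle _ (G.utilAgainst_nonneg (Tᶜ \ S) i b)
    rw [hsR i hiT hiS, hb]
    rcases hk with rfl | rfl | rfl
    · exact ha ▸ h.trans hu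
    · rwa [hb]
    · exact hc ▸ hout i hiT _ h le_rfl

end SCG
end

section
/- (Stabilization cost of the optimum is at most A_T) Let s* be a welfare-maximizing strategy vector of an SCG (u(s*) ≥ u(s) for all s). Then Σ_{i∈N} max(0, max_{k∈M} u_i(k, s*_{-i}) − u_i(s*)) ≤ A_T, i.e., the total payments required to make s* a Nash equilibrium are at most the total intrinsic utility of players' favorite strategies. -/
open Finset

namespace SCG

variable {N M : Type*} [Fintype N] [DecidableEq N] [Fintype M] [DecidableEq M]

/-- The payment needed to keep player `i` from deviating from `s`:
`max(0, max_k u_i(k, s_{-i}) − u_i(s))`. -/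
noncomputable def stabCostPlayer [Nonempty M] (G : SCG N M) (s : N → M) (i : N) : ℝ :=
  max 0 (univ.sup' univ_nonempty (fun k => G.util (Function.update s i k) i) - G.util s i)

/-- The coordination utility player `i` would additionally receive under `s` if all players using
other strategies joined `i`. -/
def crossUtil (G : SCG N M) (s : N → M) (i : N) : ℝ :=
  ∑ j ∈ univ.filter (fun j => j ≠ i ∧ s j ≠ s i), G.gam i j * G.cw i j

lemma gam_mul_cw_nonneg (G : SCG N M) (i j : N) : 0 ≤ G.gam i j * G.cw i j :=
  mul_nonneg (G.gam_nonneg i j) (G.cw_nonneg i j)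

lemma crossUtil_nonneg (G : SCG N M) (s : N → M) (i : N) : 0 ≤ G.crossUtil s i :=
  sum_nonneg fun j _ => G.gam_mul_cw_nonneg i j

lemma intrinsic_le_util (G : SCG N M) (s : N → M) (i : N) : G.w i (s i) ≤ G.util s i :=
  le_add_of_nonneg_right (sum_nonneg fun j _ => G.gam_mul_cw_nonneg i j)

lemma util_update_le_of_ne (G : SCG N M) (s : N → M) (i : N) {k : M} (hk : k ≠ s i) :
    G.util (Function.update s i k) i ≤ G.w i k + G.crossUtil s i := by
  unfold util crossUtil
  rw [Function.update_self]
  refine add_le_add_right ?_ _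
  refine sum_le_sum_of_subset_of_nonneg (fun j hj => ?_) fun j _ _ => G.gam_mul_cw_nonneg i j
  simp only [mem_filter, mem_univ, true_and] at hj ⊢
  obtain ⟨hji, hjk⟩ := hj
  rw [Function.update_of_ne hji] at hjk
  exact ⟨hji, hjk ▸ hk⟩

lemma stabCostPlayer_le [Nonempty M] (G : SCG N M) (s : N → M) (i : N) :
    G.stabCostPlayer s i ≤
      univ.sup' univ_nonempty (G.w i) - G.w i (s i) + G.crossUtil s i := by
  have hsup (k : M) : G.w i k ≤ univ.sup' univ_nonempty (G.w i) := le_sup' (G.w i) (mem_univ k)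
  have hcross := G.crossUtil_nonneg s i
  refine max_le (by linarith [hsup (s i)]) ?_
  rw [sub_le_iff_le_add]
  refine sup'_le _ _ fun k _ => ?_
  by_cases hk : k = s i
  · rw [hk, Function.update_eq_self]
    linarith [hsup (s i)]
  · linarith [G.util_update_le_of_ne s i hk, G.intrinsic_le_util s i, hsup k]

lemma util_const_add_intrinsic (G : SCG N M) (s : N → M) (i : N) (k : M) :
    G.util (fun _ => k) i + G.w i (s i) = G.w i k + G.util s i + G.crossUtil s i := by
  have hsplit := sum_filter_add_sum_filter_not (univ.filter fun j => j ≠ i) (fun j => s j = s i)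
    fun j => G.gam i j * G.cw i j
  simp only [filter_filter] at hsplit
  simp only [util, crossUtil, and_true, ne_eq] at hsplit ⊢
  linarith

/-- Gathering all players on one strategy does not beat the optimum, which bounds the total
coordination utility lost between different strategies. -/
lemma sum_crossUtil_le [Nonempty M] (G : SCG N M) (s : N → M)
    (hopt : ∀ t : N → M, G.welfare t ≤ G.welfare s) :
    ∑ i, G.crossUtil s i ≤ ∑ i, G.w i (s i) := by
  obtain ⟨k⟩ := ‹Nonempty M›
  have hconst := hopt fun _ => k
  have hsum := sum_congr rfl fun i (_ : i ∈ univ) => G.util_const_add_intrinsic s i k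
  have hk : 0 ≤ ∑ i, G.w i k := sum_nonneg fun i _ => G.w_nonneg i k
  simp only [sum_add_distrib] at hsum
  unfold welfare at hconst
  linarith

/-- Stabilizing the optimum costs at most `A_T`: the total payments required to make a
welfare-maximizing strategy vector a Nash equilibrium are at most the total intrinsic
utility of players' favorite strategies. -/
theorem stabilization_cost_le_AT [Nonempty M] (G : SCG N M) (sstar : N → M)
    (hopt : ∀ s : N → M, G.welfare s ≤ G.welfare sstar) :
    ∑ i, G.stabCostPlayer sstar i ≤ ∑ i, univ.sup' univ_nonempty (G.w i) := by
  have hcost := sum_le_sum fun i (_ : i ∈ univ) => G.stabCostPlayer_le sstar i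
  simp only [sum_add_distrib, sum_sub_distrib] at hcost
  linarith [G.sum_crossUtil_le sstar hopt]

end SCG
end

section
/- Let φ = (1+√5)/2, fix α with φ ≤ α ≤ 2, and let s* be a welfare-maximizing strategy vector of an SCG. Define the stabilization cost C = Σ_{i∈N} max(0, max_{k∈M} u_i(k, s*_{-i}) − u_i(s*)). Then there exists an α-approximate equilibrium s such that (α − 1)·C ≤ u(s). In particular, writing u(s) = ρ·u(s*), the optimum s* can be stabilized with total payments at most (ρ/(α−1))·u(s*). -/
open Finset

namespace SCG

variable {N M : Type*} [Fintype N] [DecidableEq N] [Fintype M] [DecidableEq M]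

/-- The utility player `i` derives from player `j` whenever both use the same strategy. -/
def benefit (G : SCG N M) (i j : N) : ℝ := if j = i then 0 else G.gam i j * G.cw i j

/-- The utility of player `i` for strategy `k` while the others follow `s`. -/
def devUtil (G : SCG N M) (s : N → M) (i : N) (k : M) : ℝ :=
  G.w i k + ∑ j, if s j = k then G.benefit i j else 0

theorem benefit_self (G : SCG N M) (i : N) : G.benefit i i = 0 := if_pos rfl

theorem benefit_nonneg (G : SCG N M) (i j : N) : 0 ≤ G.benefit i j := by
  unfold benefit
  split_ifs
  · exact le_rfl
  · exact mul_nonneg (G.gam_nonneg i j) (G.cw_nonneg i j)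

theorem util_eq_devUtil (G : SCG N M) (s : N → M) (i : N) :
    G.util s i = G.devUtil s i (s i) := by
  unfold util devUtil
  rw [sum_filter]
  congr 1
  refine sum_congr rfl fun j _ => ?_
  unfold benefit
  by_cases h : j = i <;> simp [h]

theorem devUtil_update (G : SCG N M) (s : N → M) (i j : N) (k l : M) :
    G.devUtil (Function.update s i k) j l = G.devUtil s j l
      + (if k = l then G.benefit j i else 0) - (if s i = l then G.benefit j i else 0) := by
  unfold devUtil
  rw [← add_sum_erase univ (fun x => if Function.update s i k x = l then _ else _) (mem_univ i),
    ← add_sum_erase univ (fun x => if s x = l then _ else _) (mem_univ i)]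
  have h : ∑ x ∈ univ.erase i, (if Function.update s i k x = l then G.benefit j x else 0)
      = ∑ x ∈ univ.erase i, if s x = l then G.benefit j x else 0 :=
    sum_congr rfl fun x hx => by rw [Function.update_of_ne (ne_of_mem_erase hx)]
  simp only [h, Function.update_self]
  ring

theorem util_update_self (G : SCG N M) (s : N → M) (i : N) (k : M) :
    G.util (Function.update s i k) i = G.devUtil s i k := by
  simp [util_eq_devUtil, devUtil_update, benefit_self]

theorem w_le_devUtil (G : SCG N M) (s : N → M) (i : N) (k : M) :
    G.w i k ≤ G.devUtil s i k := by
  refine le_add_of_nonneg_right (sum_nonneg fun j _ => ?_)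
  split_ifs
  exacts [G.benefit_nonneg i j, le_rfl]

theorem devUtil_nonneg (G : SCG N M) (s : N → M) (i : N) (k : M) : 0 ≤ G.devUtil s i k :=
  (G.w_nonneg i k).trans (G.w_le_devUtil s i k)

theorem devUtil_le (G : SCG N M) (s : N → M) (i : N) (k : M) :
    G.devUtil s i k ≤ G.w i k + ∑ j, G.benefit i j := by
  unfold devUtil
  gcongr with j
  split_ifs
  exacts [le_rfl, G.benefit_nonneg i j]

/-- Every player who has left strategy `r` is content in `s`, and remains so for as long as
other players leave `r`: even if all players still using `r` joined a third strategy,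
switching to it would not gain more than a factor `α`. -/
def SettledOutside (G : SCG N M) (α : ℝ) (r : M) (s : N → M) : Prop :=
  ∀ i, s i ≠ r →
    (∀ l, G.w i l ≤ G.devUtil s i (s i)) ∧
    G.devUtil s i r ≤ α * G.devUtil s i (s i) ∧
    ∀ l, l ≠ r → G.devUtil s i l + (G.devUtil s i r - G.w i r) ≤ α * G.devUtil s i (s i)

/-- Moving a player from `r` to a best response preserves `SettledOutside`, provided the
move improves her utility by a factor of more than `1 / (α - 1)`. -/
theorem SettledOutside.update {G : SCG N M} {α : ℝ} (hα : 1 ≤ α) {r : M} {s : N → M}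
    (hs : G.SettledOutside α r s) {i : N} (hi : s i = r) {k : M} (hk : k ≠ r)
    (hbest : ∀ l, G.devUtil s i l ≤ G.devUtil s i k)
    (hgain : G.devUtil s i r ≤ (α - 1) * G.devUtil s i k) :
    G.SettledOutside α r (Function.update s i k) := by
  intro j hj
  by_cases hji : j = i
  · subst hji
    simp only [devUtil_update, benefit_self, ite_self, add_zero, sub_zero, Function.update_self]
    have h0 := G.devUtil_nonneg s j k
    refine ⟨fun l => (G.w_le_devUtil s j l).trans (hbest l), by linarith, fun l _ => ?_⟩
    linarith [hbest l, G.w_nonneg j r]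
  · rw [Function.update_of_ne hji] at hj ⊢
    obtain ⟨h1, h2, h3⟩ := hs j hj
    have hb := G.benefit_nonneg j i
    have hu : G.devUtil s j (s j) ≤ G.devUtil (Function.update s i k) j (s j) := by
      rw [devUtil_update, hi, if_neg hj.symm]
      split_ifs <;> linarith
    have hαu := mul_le_mul_of_nonneg_left hu (zero_le_one.trans hα)
    have hr : G.devUtil (Function.update s i k) j r = G.devUtil s j r - G.benefit j i := by
      rw [devUtil_update, if_neg hk, if_pos hi, add_zero]
    refine ⟨fun l => (h1 l).trans hu, by linarith, fun l hl => ?_⟩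
    have hl' : G.devUtil (Function.update s i k) j l ≤ G.devUtil s j l + G.benefit j i := by
      rw [devUtil_update, hi, if_neg hl.symm]
      split_ifs <;> linarith
    linarith [h3 l hl]

theorem exists_settledOutside [Nonempty M] (G : SCG N M) {α : ℝ} (hα1 : 1 ≤ α) (hα2 : α ≤ 2)
    (r : M) : ∃ s : N → M, G.SettledOutside α r s ∧
      ∀ i, s i = r → ∀ k, (α - 1) * G.devUtil s i k ≤ G.devUtil s i r := by
  obtain ⟨s, hs, hmin⟩ := Set.exists_min_image {s : N → M | G.SettledOutside α r s}
    (fun s => (univ.filter fun i => s i = r).card) (Set.toFinite _)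
    ⟨fun _ => r, fun i hi => absurd rfl hi⟩
  refine ⟨s, hs, fun i hi k => ?_⟩
  by_contra! hlt
  obtain ⟨b, hb⟩ := Finite.exists_max (G.devUtil s i)
  have hb' : G.devUtil s i r < (α - 1) * G.devUtil s i b :=
    hlt.trans_le (mul_le_mul_of_nonneg_left (hb k) (by linarith))
  have hbr : b ≠ r := by
    rintro rfl
    nlinarith [G.devUtil_nonneg s i b]
  refine (hmin _ (hs.update hα1 hi hbr hb hb'.le)).not_gt (card_lt_card ?_)
  refine ⟨fun j hj => ?_, fun h => ?_⟩
  · simp only [mem_filter, mem_univ, true_and] at hj ⊢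
    by_cases hji : j = i
    · rwa [hji]
    · rwa [Function.update_of_ne hji] at hj
  · have := h (mem_filter.2 ⟨mem_univ i, hi⟩)
    simp [hbr] at this

/-- There is an `α`-approximate equilibrium in which each player obtains at least an
`α - 1` fraction of each of her intrinsic weights. -/
theorem exists_approxEq [Nonempty M] (G : SCG N M) {α : ℝ}
    (hα1 : (1 + Real.sqrt 5) / 2 ≤ α) (hα2 : α ≤ 2) :
    ∃ s : N → M, G.ApproxEq α s ∧ ∀ i k, (α - 1) * G.w i k ≤ G.util s i := by
  have h5 : 2 ≤ Real.sqrt 5 := Real.le_sqrt_of_sq_le (by norm_num)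
  have hα : 1 ≤ α := by linarith
  have hmul : 1 ≤ α * (α - 1) := by
    nlinarith [Real.sq_sqrt (show (0 : ℝ) ≤ 5 by norm_num)]
  obtain ⟨r⟩ := ‹Nonempty M›
  have : Nonempty M := ⟨r⟩
  obtain ⟨s, hs, hr⟩ := G.exists_settledOutside hα hα2 r
  refine ⟨s, fun i k => ?_, fun i k => ?_⟩
  · rw [util_update_self, util_eq_devUtil]
    by_cases hi : s i = r
    · rw [hi]
      nlinarith [mul_le_mul_of_nonneg_left (hr i hi k) (zero_le_one.trans hα),
        mul_le_mul_of_nonneg_right hmul (G.devUtil_nonneg s i k)]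
    · obtain ⟨-, h2, h3⟩ := hs i hi
      by_cases hk : k = r
      · rwa [hk]
      · linarith [h3 k hk, G.w_le_devUtil s i r]
  · rw [util_eq_devUtil]
    by_cases hi : s i = r
    · rw [hi]
      exact (mul_le_mul_of_nonneg_left (G.w_le_devUtil s i k) (by linarith)).trans (hr i hi k)
    · nlinarith [(hs i hi).1 k, G.w_nonneg i k]

/-- The cost of stabilizing a welfare-maximizing strategy vector is at most the total of the
players' largest intrinsic weights. -/
theorem sum_stabCostPlayer_le [Nonempty M] (G : SCG N M) {sstar : N → M}
    (hopt : ∀ s : N → M, G.welfare s ≤ G.welfare sstar) {b : N → M}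
    (hb : ∀ i k, G.w i k ≤ G.w i (b i)) :
    ∑ i, G.stabCostPlayer sstar i ≤ ∑ i, G.w i (b i) := by
  obtain ⟨r⟩ := ‹Nonempty M›
  have : Nonempty M := ⟨r⟩
  have hcost : ∀ i, G.stabCostPlayer sstar i ≤
      G.w i (b i) + ∑ j, G.benefit i j - G.util sstar i := by
    intro i
    have hdev : ∀ k, G.devUtil sstar i k ≤ G.w i (b i) + ∑ j, G.benefit i j := fun k =>
      (G.devUtil_le sstar i k).trans (by linarith [hb i k])
    refine max_le ?_ (sub_le_sub_right (sup'_le _ _ fun k _ => ?_) _)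
    · rw [util_eq_devUtil]
      exact sub_nonneg.2 (hdev _)
    · rw [util_update_self]
      exact hdev k
  have hconst : ∑ i, ∑ j, G.benefit i j ≤ G.welfare fun _ => r := by
    refine sum_le_sum fun i _ => ?_
    simp only [util_eq_devUtil, devUtil, if_true]
    linarith [G.w_nonneg i r]
  have hsum := sum_le_sum fun i (_ : i ∈ univ) => hcost i
  rw [sum_sub_distrib, sum_add_distrib] at hsum
  have := hopt fun _ => r
  rw [show ∑ i, G.util sstar i = G.welfare sstar from rfl] at hsum
  linarith

/-- For `φ ≤ α ≤ 2` there is an `α`-approximate equilibrium `s` with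
`(α−1)·C ≤ u(s)`, where `C` is the total payment required to stabilize the
welfare-maximizing strategy vector `s*`. -/
theorem stabilization_vs_approx [Nonempty N] [Nonempty M] (G : SCG N M) (α : ℝ)
    (hα1 : (1 + Real.sqrt 5) / 2 ≤ α) (hα2 : α ≤ 2)
    (sstar : N → M) (hopt : ∀ s : N → M, G.welfare s ≤ G.welfare sstar) :
    ∃ s : N → M, G.ApproxEq α s ∧
      (α - 1) * (∑ i, G.stabCostPlayer sstar i) ≤ G.welfare s := by
  obtain ⟨s, hs, hw⟩ := G.exists_approxEq hα1 hα2
  choose b hb using fun i => Finite.exists_max (G.w i)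
  refine ⟨s, hs, ?_⟩
  calc (α - 1) * ∑ i, G.stabCostPlayer sstar i
      ≤ (α - 1) * ∑ i, G.w i (b i) :=
        mul_le_mul_of_nonneg_left (G.sum_stabCostPlayer_le hopt hb)
          (by linarith [Real.le_sqrt_of_sq_le (show (2 : ℝ) ^ 2 ≤ 5 by norm_num)])
    _ = ∑ i, (α - 1) * G.w i (b i) := mul_sum _ _ _
    _ ≤ G.welfare s := sum_le_sum fun i _ => hw i (b i)

end SCG
end

section
/- Every SCG with exactly 2 strategies admits a strong equilibrium. -/
open Finset

namespace SCG

variable {N M : Type*} [Fintype N] [DecidableEq N] [Fintype M] [DecidableEq M]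

/-- Strong equilibrium: no nonempty coalition can deviate so that every member of the
coalition strictly improves. -/
def StrongEq (G : SCG N M) (s : N → M) : Prop :=
  ¬ ∃ (S : Finset N) (s' : N → M), S.Nonempty ∧ (∀ i ∉ S, s' i = s i) ∧
      ∀ i ∈ S, G.util s i < G.util s' i

/-- The utility player `i` would get by playing `k` together with the players in `X`. -/
def utilWith (G : SCG N M) (i : N) (k : M) (X : Finset N) : ℝ :=
  G.w i k + ∑ j ∈ X.erase i, G.gam i j * G.cw i j

lemma utilWith_mono (G : SCG N M) (i : N) (k : M) : Monotone (G.utilWith i k) := fun _ _ h =>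
  add_le_add_right (sum_le_sum_of_subset_of_nonneg (erase_subset_erase i h) fun j _ _ =>
    mul_nonneg (G.gam_nonneg i j) (G.cw_nonneg i j)) _

lemma util_eq_utilWith (G : SCG N M) (s : N → M) (i : N) :
    G.util s i = G.utilWith i (s i) (univ.filter fun j => s j = s i) := by
  unfold util utilWith
  congr 2
  ext j
  simp

/-- When exactly the players in `X` play `b` and the others play `a`, no nonempty coalition of
players in `X` can profitably switch from `b` to `a`. -/
def NoReturn (G : SCG N M) (a b : M) (X : Finset N) : Prop :=
  ∀ T ⊆ X, T.Nonempty → ∃ i ∈ T, G.utilWith i a (Xᶜ ∪ T) ≤ G.utilWith i b X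

lemma NoReturn.union {G : SCG N M} {a b : M} {X S : Finset N} (hX : G.NoReturn a b X)
    (hS : ∀ i ∈ S, G.utilWith i a Xᶜ < G.utilWith i b (X ∪ S)) :
    G.NoReturn a b (X ∪ S) := by
  intro T hT hne
  by_cases h : (T ∩ X).Nonempty
  · obtain ⟨i, hi, hle⟩ := hX _ inter_subset_right h
    refine ⟨i, (mem_inter.1 hi).1, ?_⟩
    calc G.utilWith i a ((X ∪ S)ᶜ ∪ T) ≤ G.utilWith i a (Xᶜ ∪ T ∩ X) :=
          G.utilWith_mono i a fun j hj => by simp at hj ⊢; tauto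
      _ ≤ G.utilWith i b X := hle
      _ ≤ G.utilWith i b (X ∪ S) := G.utilWith_mono i b subset_union_left
  · have hd : ∀ j ∈ T, j ∉ X := fun j hj hjX => h ⟨j, mem_inter.2 ⟨hj, hjX⟩⟩
    obtain ⟨i, hi⟩ := hne
    have hiS : i ∈ S := (mem_union.1 (hT hi)).resolve_left (hd i hi)
    refine ⟨i, hi, (G.utilWith_mono i a fun j hj => ?_).trans (hS i hiS).le⟩
    have := hd j
    simp at hj ⊢
    tauto

/-- Some set of players can be assigned `b`, and the others `a`, so that no coalition profits by a
one-directional switch, in either direction. -/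
lemma exists_noReturn_forall_exists_le (G : SCG N M) (a b : M) :
    ∃ X : Finset N, G.NoReturn a b X ∧ ∀ S : Finset N, Disjoint S X → S.Nonempty →
      ∃ i ∈ S, G.utilWith i b (X ∪ S) ≤ G.utilWith i a Xᶜ := by
  obtain ⟨X, hX⟩ := (Set.toFinite {X | G.NoReturn a b X}).exists_maximal
    ⟨∅, fun T hT hne => absurd (subset_empty.1 hT) hne.ne_empty⟩
  refine ⟨X, hX.prop, fun S hd hne => ?_⟩
  by_contra! hS
  obtain ⟨i, hi⟩ := hne
  have hle : X ∪ S ≤ X := hX.le_of_ge (hX.prop.union hS) subset_union_left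
  exact disjoint_left.1 hd hi (hle (mem_union_right _ hi))

/-- Every SCG with exactly two strategies admits a strong equilibrium. -/
theorem exists_strong_two_strategies [Nonempty N] (G : SCG N M)
    (hM : Fintype.card M = 2) :
    ∃ s : N → M, G.StrongEq s := by
  obtain ⟨a, b, hab, huniv⟩ := Finset.card_eq_two.1 (Finset.card_univ.trans hM)
  have hor (k : M) : k = a ∨ k = b := by simpa [huniv] using mem_univ k
  obtain ⟨X, hdown, hup⟩ := G.exists_noReturn_forall_exists_le a b
  set s : N → M := fun j => if j ∈ X then b else a with hs
  have hsb (j : N) : s j = b ↔ j ∈ X := by by_cases hj : j ∈ X <;> simp [hs, hj, hab]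
  have hsa (j : N) : s j = a ↔ j ∉ X := by by_cases hj : j ∈ X <;> simp [hs, hj, hab.symm]
  refine ⟨s, ?_⟩
  rintro ⟨S, s', ⟨i₀, hi₀⟩, hout, himp⟩
  have hmem (j : N) (hj : s' j ≠ s j) : j ∈ S := by
    by_contra h
    exact hj (hout j h)
  have hstayX : ∀ j ∈ X, s' j = b := by
    by_contra! ⟨j, hjX, hj⟩
    obtain ⟨i, hi, hle⟩ := hdown (X.filter fun j => s' j ≠ b) (filter_subset _ _)
      ⟨j, mem_filter.2 ⟨hjX, hj⟩⟩
    obtain ⟨hiX, hi⟩ := mem_filter.1 hi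
    have hsi := (hsb i).2 hiX
    have hlt := himp i (hmem i (hsi ▸ hi))
    rw [util_eq_utilWith, util_eq_utilWith, hsi, (hor (s' i)).resolve_right hi] at hlt
    refine (hlt.trans_le (G.utilWith_mono i a fun l hl => ?_)).not_ge (hle.trans_eq ?_)
    · have : s' l = a := by simpa using hl
      by_cases hlX : l ∈ X <;> simp [hlX, this, hab]
    · congr 1
      ext l
      simp [hsb]
  have hstay : ∀ j ∉ X, s' j = a := by
    by_contra! ⟨j, hjX, hj⟩
    obtain ⟨i, hi, hle⟩ := hup (Xᶜ.filter fun j => s' j ≠ a)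
      (disjoint_left.2 fun l hl => by simpa using (mem_filter.1 hl).1)
      ⟨j, mem_filter.2 ⟨mem_compl.2 hjX, hj⟩⟩
    obtain ⟨hiX, hi⟩ := mem_filter.1 hi
    have hsi := (hsa i).2 (mem_compl.1 hiX)
    have hlt := himp i (hmem i (hsi ▸ hi))
    rw [util_eq_utilWith, util_eq_utilWith, hsi, (hor (s' i)).resolve_left hi] at hlt
    refine (hlt.trans_le (G.utilWith_mono i b fun l hl => ?_)).not_ge (hle.trans_eq ?_)
    · have : s' l = b := by simpa using hl
      by_cases hlX : l ∈ X <;> simp [hlX, this, hab.symm]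
    · congr 1
      ext l
      simp [hsa]
  have hss : s' = s := by
    funext j
    by_cases hj : j ∈ X
    · rw [hstayX j hj, (hsb j).2 hj]
    · rw [hstay j hj, (hsa j).2 hj]
  exact (himp i₀ hi₀).ne (by rw [hss])

end SCG
end

section
/- (Strong Price of Anarchy at most 2 for symmetric games) In a symmetric SCG, every strong equilibrium s satisfies 2·u(s) ≥ u(s') for every strategy vector s'. -/
open Finset

namespace SCG

variable {N M : Type*} [Fintype N] [DecidableEq N] [Fintype M] [DecidableEq M]

/-- The utility player `i` draws from the other members of `S`, when all of them play `s`,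
is at most the utility of `i` when only the members of `S` are known to play `s`. -/
theorem restricted_util_le (G : SCG N M) (s t : N → M) (S : Finset N) (i : N) (hi : i ∈ S)
    (h : ∀ j ∈ S, t j = s j) :
    G.w i (s i) + ∑ j ∈ S.erase i, (if s j = s i then G.gam i j * G.cw i j else 0)
      ≤ G.util t i := by
  unfold util
  rw [h i hi, ← sum_filter]
  refine add_le_add_right (sum_le_sum_of_subset_of_nonneg ?_ ?_) _
  · intro j hj
    simp only [mem_filter, mem_erase] at hj
    simp [hj.1.1, h j hj.1.2, hj.2]
  · exact fun j _ _ => mul_nonneg (G.gam_nonneg i j) (G.cw_nonneg i j)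

/-- In a symmetric game, the welfare of the players of `S` under `s'`, counting only
coordination inside `S`, is at most twice their welfare in a strong equilibrium `s`. -/
theorem StrongEq.restricted_welfare_le {G : SCG N M}
    (hsym : ∀ i j : N, i ≠ j → G.gam i j = 1 / 2) {s : N → M} (hs : G.StrongEq s)
    (s' : N → M) (S : Finset N) :
    ∑ i ∈ S, (G.w i (s' i) +
        ∑ j ∈ S.erase i, (if s' j = s' i then G.gam i j * G.cw i j else 0))
      ≤ 2 * ∑ i ∈ S, G.util s i := by
  induction S using Finset.strongInduction with
  | H S ih =>
  rcases S.eq_empty_or_nonempty with rfl | hS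
  · simp
  let t : N → M := fun j => if j ∈ S then s' j else s j
  obtain ⟨i, hi, hle⟩ : ∃ i ∈ S, G.util t i ≤ G.util s i := by
    by_contra! hc
    exact hs ⟨S, t, hS, fun j hj => if_neg hj, hc⟩
  have hgain := (G.restricted_util_le s' t S i hi fun j hj => if_pos hj).trans hle
  have hrec := ih _ (erase_ssubset hi)
  have hsplit : ∑ k ∈ S.erase i, (G.w k (s' k) +
        ∑ j ∈ S.erase k, (if s' j = s' k then G.gam k j * G.cw k j else 0))
      = ∑ k ∈ S.erase i, (G.w k (s' k) +
          ∑ j ∈ (S.erase i).erase k, (if s' j = s' k then G.gam k j * G.cw k j else 0))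
        + ∑ k ∈ S.erase i, (if s' k = s' i then G.gam i k * G.cw i k else 0) := by
    rw [← sum_add_distrib]
    refine sum_congr rfl fun k hk => ?_
    have hki : k ≠ i := ne_of_mem_erase hk
    rw [← sum_erase_add (S.erase k) _ (mem_erase.2 ⟨hki.symm, hi⟩), erase_right_comm,
      hsym k i hki, hsym i k hki.symm, G.cw_symm k i, ← add_assoc]
    simp only [eq_comm]
  rw [← sum_erase_add S _ hi, ← sum_erase_add S (G.util s) hi, hsplit]
  linarith [G.w_nonneg i (s' i)]

/-- Strong Price of Anarchy at most 2 for symmetric SCGs: every strong equilibrium has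
at least half the welfare of any strategy vector. -/
theorem spoa_symmetric (G : SCG N M)
    (hsym : ∀ i j : N, i ≠ j → G.gam i j = 1 / 2)
    (s : N → M) (hs : G.StrongEq s) :
    ∀ s' : N → M, G.welfare s' ≤ 2 * G.welfare s := by
  intro s'
  have h := hs.restricted_welfare_le hsym s' univ
  refine le_of_eq_of_le (sum_congr rfl fun i _ => ?_) h
  rw [util, ← sum_filter]
  congr 2
  ext j
  simp

end SCG
end

section
/- (ω-extension admits a 1/ω-approximate strong equilibrium) Let N be a finite nonempty set of players with weights a_i > 0 and b_i > 0, let M be a finite nonempty set of strategies, fix ω with 1/2 ≤ ω ≤ 1, and partition the unordered pairs of distinct players into friend pairs, neutral pairs, and conflict pairs. Call a strategy vector s admissible if no conflict pair shares a strategy, and define the utility of player i under admissible s as u_i(s) = a_i·( Σ_{j : s_j = s_i, {i,j} a friend pair} b_j + ω·Σ_{j : s_j = s_i, {i,j} a neutral pair} b_j ). If the set of admissible strategy vectors is nonempty, then there exists an admissible strategy vector s such that for every nonempty coalition S ⊆ N and every admissible strategy vector s' agreeing with s outside S, some i ∈ S has ω·u_i(s') ≤ u_i(s). In particular, for ω =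 1 an admissible strong equilibrium exists. -/
open Finset

/-- A strategy vector is admissible if no conflict pair shares a strategy. -/
def Admissible {N M : Type*} (conflict : N → N → Bool) (s : N → M) : Prop :=
  ∀ i j : N, i ≠ j → conflict i j = true → s i ≠ s j

/-- Utility of player `i` in the ω-extension: full benefit `a_i·b_j` from friends sharing
her strategy, and a fraction `ω` of it from neutral players sharing her strategy. -/
def omegaUtil {N M : Type*} [Fintype N] [DecidableEq N] [DecidableEq M]
    (a b : N → ℝ) (ω : ℝ) (friend conflict : N → N → Bool) (s : N → M) (i : N) : ℝ :=
  a i * ((∑ j ∈ univ.filter (fun j => j ≠ i ∧ s j = s i ∧ friend i j = true), b j) +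
    ω * ∑ j ∈ univ.filter
        (fun j => j ≠ i ∧ s j = s i ∧ friend i j = false ∧ conflict i j = false), b j)

/-- The total weight of the players who choose strategy `m` under `s`. -/
def groupWeight {N M : Type*} [Fintype N] [DecidableEq M] (b : N → ℝ) (s : N → M) (m : M) : ℝ :=
  ∑ j ∈ univ.filter (fun j => s j = m), b j

/-- `Dominates w' w` says that for some threshold `t` all values of `w` that are at least `t`
are kept by `w'`, while some value below `t` is raised to at least `t`. -/
def Dominates {M : Type*} (w' w : M → ℝ) : Prop :=
  ∃ t : ℝ, (∀ m, t ≤ w m → w' m = w m) ∧ ∃ m, w m < t ∧ t ≤ w' m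

theorem Dominates.irrefl {M : Type*} (w : M → ℝ) : ¬ Dominates w w := by
  rintro ⟨t, -, m, h₁, h₂⟩
  exact absurd h₁ (not_lt.mpr h₂)

theorem Dominates.trans {M : Type*} {w₁ w₂ w₃ : M → ℝ}
    (h₁₂ : Dominates w₁ w₂) (h₂₃ : Dominates w₂ w₃) : Dominates w₁ w₃ := by
  obtain ⟨t, ht, m, hm, hm'⟩ := h₁₂
  obtain ⟨r, hr, n, hn, hn'⟩ := h₂₃
  rcases le_total t r with h | h
  · refine ⟨r, fun p hp => ?_, n, hn, ?_⟩
    · have := hr p hp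
      rw [ht p (by linarith), this]
    · rwa [ht n (by linarith)]
  · refine ⟨t, fun p hp => ?_, m, ?_, hm'⟩
    · have := hr p (by linarith)
      rw [ht p (by linarith), this]
    · by_contra! hc
      have := hr m (by linarith)
      linarith

/-- If every member of a nonempty coalition moves to a strictly heavier group, then the new
group weights dominate the old ones. -/
theorem dominates_groupWeight {N M : Type*} [Fintype N] [DecidableEq M]
    {b : N → ℝ} (hb : ∀ i, 0 < b i) {s s' : N → M} {S : Finset N} (hS : S.Nonempty)
    (hagree : ∀ i ∉ S, s' i = s i)
    (hlt : ∀ i ∈ S, groupWeight b s (s i) < groupWeight b s' (s' i)) :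
    Dominates (groupWeight b s') (groupWeight b s) := by
  obtain ⟨k, hk, hmax⟩ := S.exists_max_image (fun i => groupWeight b s' (s' i)) hS
  set t := groupWeight b s' (s' k) with ht
  have hleave : ∀ p, t ≤ groupWeight b s p → ∀ i ∈ S, s i ≠ p := by
    rintro p hp i hi rfl
    linarith [hlt i hi, hmax i hi]
  have hjoin : ∀ p, t ≤ groupWeight b s p → ∀ i ∈ S, s' i ≠ p := by
    rintro p hp i hi rfl
    have : groupWeight b s (s' i) < groupWeight b s' (s' i) := by
      refine sum_lt_sum_of_subset (i := i) (fun j hj => ?_) (by simp)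
        (by simpa using hleave _ hp i hi) (hb i) (fun j _ _ => (hb j).le)
      simp only [mem_filter, mem_univ, true_and] at hj ⊢
      rw [hagree j fun hjS => hleave _ hp j hjS hj, hj]
    linarith [hmax i hi]
  refine ⟨t, fun p hp => ?_, s' k, ?_, ht.le⟩
  · refine sum_congr (filter_congr fun j _ => ?_) fun _ _ => rfl
    by_cases hj : j ∈ S
    · simp [hleave p hp j hj, hjoin p hp j hj]
    · rw [hagree j hj]
  · by_contra! hc
    exact hjoin _ hc k hk rfl

theorem sum_ne_and_eq_groupWeight_sub {N M : Type*} [Fintype N] [DecidableEq N] [DecidableEq M]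
    (b : N → ℝ) (s : N → M) (i : N) :
    ∑ j ∈ univ.filter (fun j => j ≠ i ∧ s j = s i), b j = groupWeight b s (s i) - b i := by
  rw [groupWeight, ← sum_erase_eq_sub (by simp)]
  congr 1
  ext j
  simp

theorem omegaUtil_le {N M : Type*} [Fintype N] [DecidableEq N] [DecidableEq M]
    {a b : N → ℝ} (ha : ∀ i, 0 < a i) (hb : ∀ i, 0 < b i) {ω : ℝ} (hω : ω ≤ 1)
    (friend conflict : N → N → Bool) (s : N → M) (i : N) :
    omegaUtil a b ω friend conflict s i ≤ a i * (groupWeight b s (s i) - b i) := by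
  rw [← sum_ne_and_eq_groupWeight_sub,
    ← sum_filter_add_sum_filter_not _ (fun j => friend i j = true), filter_filter, filter_filter]
  refine mul_le_mul_of_nonneg_left (add_le_add ?_ ?_) (ha i).le
  · simp only [and_assoc, le_refl]
  · refine (mul_le_of_le_one_left (sum_nonneg fun j _ => (hb j).le) hω).trans
      (sum_le_sum_of_subset_of_nonneg (fun j => ?_) fun j _ _ => (hb j).le)
    simp +contextual

theorem le_omegaUtil {N M : Type*} [Fintype N] [DecidableEq N] [DecidableEq M]
    {a b : N → ℝ} (ha : ∀ i, 0 < a i) (hb : ∀ i, 0 < b i) {ω : ℝ} (hω : ω ≤ 1)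
    (friend : N → N → Bool) {conflict : N → N → Bool} {s : N → M}
    (hs : Admissible conflict s) (i : N) (hω0 : 0 ≤ ω) :
    ω * (a i * (groupWeight b s (s i) - b i)) ≤ omegaUtil a b ω friend conflict s i := by
  rw [← sum_ne_and_eq_groupWeight_sub,
    ← sum_filter_add_sum_filter_not _ (fun j => friend i j = true), filter_filter, filter_filter,
    mul_left_comm, mul_add]
  refine mul_le_mul_of_nonneg_left (add_le_add ?_ (mul_le_mul_of_nonneg_left ?_ hω0)) (ha i).le
  · simp only [and_assoc]
    exact mul_le_of_le_one_left (sum_nonneg fun j _ => (hb j).le) hω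
  · refine sum_le_sum_of_subset_of_nonneg (fun j => ?_) fun j _ _ => (hb j).le
    simp only [mem_filter, mem_univ, true_and, Bool.not_eq_true]
    rintro ⟨⟨hne, heq⟩, hf⟩
    refine ⟨hne, heq, hf, ?_⟩
    by_contra hc
    exact hs i j hne.symm (by simpa using hc) heq.symm

/-- The ω-extension of an SCG obeying the correlated coordination condition admits a
`1/ω`-approximate strong equilibrium (within admissible strategy vectors): there is an
admissible `s` such that for every coalitional deviation to an admissible `s'`, some
member `i` of the coalition has `ω·u_i(s') ≤ u_i(s)`.  In particular, for `ω = 1` an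
admissible strong equilibrium exists. -/
theorem omega_extension_approx_strong
    {N M : Type*} [Fintype N] [DecidableEq N] [Nonempty N]
    [Fintype M] [DecidableEq M] [Nonempty M]
    (a b : N → ℝ) (ha : ∀ i, 0 < a i) (hb : ∀ i, 0 < b i)
    (ω : ℝ) (hω1 : 1 / 2 ≤ ω) (hω2 : ω ≤ 1)
    (friend conflict : N → N → Bool)
    (hfriend_symm : ∀ i j, friend i j = friend j i)
    (hconflict_symm : ∀ i j, conflict i j = conflict j i)
    (hdisjoint : ∀ i j, ¬ (friend i j = true ∧ conflict i j = true))
    (hex : ∃ s : N → M, Admissible conflict s) :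
    ∃ s : N → M, Admissible conflict s ∧
      ∀ S : Finset N, S.Nonempty → ∀ s' : N → M, Admissible conflict s' →
        (∀ i ∉ S, s' i = s i) →
        ∃ i ∈ S, ω * omegaUtil a b ω friend conflict s' i ≤
          omegaUtil a b ω friend conflict s i := by
  have hω0 : 0 < ω := by linarith
  let r : (N → M) → (N → M) → Prop := fun x y => Dominates (groupWeight b x) (groupWeight b y)
  have : IsTrans (N → M) r := ⟨fun _ _ _ => Dominates.trans⟩
  have : Std.Irrefl r := ⟨fun _ => Dominates.irrefl _⟩
  obtain ⟨s, hs, hmin⟩ :=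
    (Finite.wellFounded_of_trans_of_irrefl r).has_min {s | Admissible conflict s} hex
  refine ⟨s, hs, fun S hS s' hs' hagree => ?_⟩
  by_contra! hdev
  refine hmin s' hs' (dominates_groupWeight hb hS hagree fun i hi => ?_)
  have hchain := (le_omegaUtil ha hb hω2 friend hs i hω0.le).trans_lt <| (hdev i hi).trans_le <|
    mul_le_mul_of_nonneg_left (omegaUtil_le ha hb hω2 friend conflict s' i) hω0.le
  have := lt_of_mul_lt_mul_left (lt_of_mul_lt_mul_left hchain hω0.le) (ha i).le
  linarith
end

section
/- For every real c > 1, there exists a three-player, three-strategy game in which each player's utility U_i(s) depends only on her own strategy s_i and the set of players choosing the same strategy, and such that for every strategy vector s there exist a player i and a strategy k with U_i(k, s_{-i}) ≥ c·U_i(s) and U_i(k, s_{-i}) > U_i(s). Consequently this game admits no α-approximate equilibrium for any 1 ≤ α < c. -/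
/-- For every `c > 1` there is a three-player, three-strategy game — each player's
utility depending only on her own strategy and the set of players choosing the same
strategy — in which, in every strategy vector, some player can deviate and improve her
utility by a factor of at least `c`.  Consequently the game admits no `α`-approximate
equilibrium for any `1 ≤ α < c`. -/
theorem no_approx_equilibrium_with_complements (c : ℝ) (hc : 1 < c) :
    ∃ U : Fin 3 → (Fin 3 → Fin 3) → ℝ,
      (∀ (i : Fin 3) (s : Fin 3 → Fin 3), 0 ≤ U i s) ∧
      (∀ (i : Fin 3) (s s' : Fin 3 → Fin 3), s i = s' i →
        (∀ j, s j = s i ↔ s' j = s' i) → U i s = U i s') ∧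
      (∀ s : Fin 3 → Fin 3, ∃ (i : Fin 3) (k : Fin 3),
        c * U i s ≤ U i (Function.update s i k) ∧ U i s < U i (Function.update s i k)) ∧
      (∀ α : ℝ, 1 ≤ α → α < c →
        ¬ ∃ s : Fin 3 → Fin 3, ∀ (i : Fin 3) (k : Fin 3),
            U i (Function.update s i k) ≤ α * U i s) := by
  -- Matching pennies: player 0 wants to join player 1, who wants to avoid player 0.
  have key : ∀ U : Fin 3 → (Fin 3 → Fin 3) → ℝ, (∀ i s, 0 < U i s) →
      (∀ s : Fin 3 → Fin 3, ∃ i k, c * U i s ≤ U i (Function.update s i k)) →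
      (∀ s : Fin 3 → Fin 3, ∃ (i : Fin 3) (k : Fin 3),
        c * U i s ≤ U i (Function.update s i k) ∧ U i s < U i (Function.update s i k)) ∧
      (∀ α : ℝ, 1 ≤ α → α < c →
        ¬ ∃ s : Fin 3 → Fin 3, ∀ (i : Fin 3) (k : Fin 3),
            U i (Function.update s i k) ≤ α * U i s) := by
    intro U hpos hdev
    refine ⟨fun s => ?_, ?_⟩
    · obtain ⟨i, k, h⟩ := hdev s
      exact ⟨i, k, h, (lt_mul_of_one_lt_left (hpos i s) hc).trans_le h⟩
    · rintro α - hα ⟨s, hs⟩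
      obtain ⟨i, k, h⟩ := hdev s
      exact absurd (h.trans (hs i k)) (not_le.2 (mul_lt_mul_of_pos_right hα (hpos i s)))
  let U : Fin 3 → (Fin 3 → Fin 3) → ℝ := fun i s =>
    if i = 0 ∧ s 1 = s i ∨ i = 1 ∧ s 0 ≠ s i then c else 1
  have hU : ∀ i s, 0 < U i s := by
    intro i s
    dsimp only [U]
    split_ifs <;> linarith
  refine ⟨U, fun i s => (hU i s).le, ?_, key U hU ?_⟩
  · intro i s s' _ h
    simp only [U, ne_eq, h]
  · intro s
    by_cases h : s 0 = s 1
    · refine ⟨1, s 0 + 1, ?_⟩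
      simp [U, h]
    · refine ⟨0, s 1, ?_⟩
      simp [U, Ne.symm h]
end

section
/- (Hypergraph SCG with Correlated Coordination) Consider a hypergraph social coordination game: a finite nonempty set N of players with weights γ_i > 0, a finite set M of strategies, and a finite family of hyperedges, where each hyperedge e consists of a nonempty player set P_e ⊆ N, an anchor set K_e ⊆ M with |K_e| ≤ 1, and a weight w_e ≥ 0. Under a strategy vector s, hyperedge e is active at strategy k if s_j = k for all j ∈ P_e and K_e ⊆ {k}; player i's utility is u_i(s) = Σ over hyperedges e with i ∈ P_e that are active at s_i of (γ_i / Σ_{j∈P_e} γ_j)·w_e. Then Φ(s) = Σ over hyperedges e active at some strategy of w_e / Σ_{j∈P_e} γ_j is an ordinal potential function: for every strategy vector s, player i, and strategy k, u_i(k, s_{-i}) > u_i(s) if and only if Φ(k, s_{-i}) > Φ(s). Consequently this game has a Nash equilibrium. -/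
open Finset

/-- In a hypergraph SCG, hyperedge `e` is active at strategy `k` under `s` if all of its
players choose `k` and its anchor set is contained in `{k}`. -/
def HActive {N M E : Type*} (P : E → Finset N) (K : E → Finset M)
    (s : N → M) (e : E) (k : M) : Prop :=
  (∀ j ∈ P e, s j = k) ∧ K e ⊆ {k}

instance {N M E : Type*} [DecidableEq N] [DecidableEq M]
    (P : E → Finset N) (K : E → Finset M) (s : N → M) (e : E) (k : M) :
    Decidable (HActive P K s e k) := by
  unfold HActive; infer_instance

/-- Player `i`'s utility in a hypergraph SCG obeying the correlated coordination
condition: she receives a share `γ_i / Σ_{j ∈ P_e} γ_j` of the weight of each hyperedge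
containing her that is active at her strategy. -/
noncomputable def hUtil {N M E : Type*} [Fintype N] [DecidableEq N]
    [Fintype M] [DecidableEq M] [Fintype E]
    (γ : N → ℝ) (P : E → Finset N) (K : E → Finset M) (w : E → ℝ)
    (s : N → M) (i : N) : ℝ :=
  ∑ e ∈ univ.filter (fun e => i ∈ P e ∧ HActive P K s e (s i)),
    (γ i / ∑ j ∈ P e, γ j) * w e

/-- The potential `Φ(s) = Σ_{e active at some strategy} w_e / Σ_{j ∈ P_e} γ_j`. -/
noncomputable def hPhi {N M E : Type*} [Fintype N] [DecidableEq N]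
    [Fintype M] [DecidableEq M] [Fintype E]
    (γ : N → ℝ) (P : E → Finset N) (K : E → Finset M) (w : E → ℝ)
    (s : N → M) : ℝ :=
  ∑ e ∈ univ.filter (fun e => ∃ k, HActive P K s e k), w e / ∑ j ∈ P e, γ j

theorem HActive.eq_of_mem {N M E : Type*} {P : E → Finset N} {K : E → Finset M}
    {s : N → M} {e : E} {k : M} (h : HActive P K s e k) {i : N} (hi : i ∈ P e) : k = s i :=
  (h.1 i hi).symm

theorem hActive_update_iff {N M E : Type*} [DecidableEq N] {P : E → Finset N}
    {K : E → Finset M} {e : E} {i : N} (hi : i ∉ P e) (s : N → M) (k l : M) :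
    HActive P K (Function.update s i k) e l ↔ HActive P K s e l := by
  refine and_congr_left fun _ => forall₂_congr fun j hj => ?_
  rw [Function.update_of_ne (ne_of_mem_of_not_mem hj hi)]

/-- The rescaled potential `γ i * Φ` splits into the utility of player `i` and a contribution
of the hyperedges not containing `i`. -/
theorem mul_hPhi_eq {N M E : Type*} [Fintype N] [DecidableEq N]
    [Fintype M] [DecidableEq M] [Fintype E]
    (γ : N → ℝ) (P : E → Finset N) (K : E → Finset M) (w : E → ℝ) (s : N → M) (i : N) :
    γ i * hPhi γ P K w s = hUtil γ P K w s i +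
      γ i * ∑ e ∈ univ.filter (fun e => i ∉ P e ∧ ∃ k, HActive P K s e k),
        w e / ∑ j ∈ P e, γ j := by
  simp only [hPhi, hUtil, mul_sum, sum_filter, ← sum_add_distrib]
  refine sum_congr rfl fun e _ => ?_
  by_cases hi : i ∈ P e
  · have h : (∃ k, HActive P K s e k) ↔ HActive P K s e (s i) :=
      ⟨fun ⟨_, hk⟩ => hk.eq_of_mem hi ▸ hk, fun hk => ⟨_, hk⟩⟩
    simp only [hi, h, true_and, not_true_eq_false, false_and, if_false, add_zero, mul_zero]
    split_ifs <;> ring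
  · simp [hi]

/-- A unilateral deviation of player `i` changes her utility by `γ i` times the change of the
potential. -/
theorem hUtil_update_sub {N M E : Type*} [Fintype N] [DecidableEq N]
    [Fintype M] [DecidableEq M] [Fintype E]
    (γ : N → ℝ) (P : E → Finset N) (K : E → Finset M) (w : E → ℝ) (s : N → M) (i : N) (k : M) :
    hUtil γ P K w (Function.update s i k) i - hUtil γ P K w s i =
      γ i * (hPhi γ P K w (Function.update s i k) - hPhi γ P K w s) := by
  have h : univ.filter (fun e => i ∉ P e ∧ ∃ l, HActive P K (Function.update s i k) e l) =
      univ.filter (fun e => i ∉ P e ∧ ∃ l, HActive P K s e l) :=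
    filter_congr fun e _ => and_congr_right fun hi =>
      exists_congr fun l => hActive_update_iff hi s k l
  rw [mul_sub, mul_hPhi_eq γ P K w (Function.update s i k) i, mul_hPhi_eq γ P K w s i, h]
  ring

/-- Hypergraph SCGs obeying the Correlated Coordination condition admit `hPhi` as an
ordinal potential function; consequently they have a Nash equilibrium. -/
theorem hypergraph_cc_potential_and_nash
    {N M E : Type*} [Fintype N] [DecidableEq N] [Nonempty N]
    [Fintype M] [DecidableEq M] [Nonempty M] [Fintype E]
    (γ : N → ℝ) (hγ : ∀ i, 0 < γ i)
    (P : E → Finset N) (hP : ∀ e, (P e).Nonempty)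
    (K : E → Finset M) (hK : ∀ e, (K e).card ≤ 1)
    (w : E → ℝ) (hw : ∀ e, 0 ≤ w e) :
    (∀ (s : N → M) (i : N) (k : M),
      hUtil γ P K w s i < hUtil γ P K w (Function.update s i k) i ↔
      hPhi γ P K w s < hPhi γ P K w (Function.update s i k)) ∧
    ∃ s : N → M, ∀ (i : N) (k : M),
      hUtil γ P K w (Function.update s i k) i ≤ hUtil γ P K w s i := by
  have key : ∀ (s : N → M) (i : N) (k : M),
      hUtil γ P K w s i < hUtil γ P K w (Function.update s i k) i ↔
      hPhi γ P K w s < hPhi γ P K w (Function.update s i k) := fun s i k => by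
    rw [← sub_pos, hUtil_update_sub, mul_pos_iff_of_pos_left (hγ i), sub_pos]
  obtain ⟨s, hs⟩ := Finite.exists_max (hPhi γ P K w)
  exact ⟨key, s, fun i k => not_lt.1 fun h => (hs _).not_gt ((key s i k).1 h)⟩
end

section
/- (Social coordination with bounded supermodularity) Let N be a finite nonempty set of players, M a finite nonempty set of strategies, and for each player i let v_i be a nonnegative real-valued function on finite subsets of the disjoint union N ⊔ M; player i's utility under a strategy vector s is U_i(s) = v_i({s_i} ∪ {j ∈ N : s_j = s_i}). Suppose each v_i is monotone (S ⊆ T implies v_i(S) ≤ v_i(T)) and r-supermodular for some r ≥ 1, meaning v_i(S ∪ T) ≤ r·(v_i(S) + v_i(T)) for all finite sets S, T. Then the game admits an α-approximate equilibrium with α = (r + √(r² + 4r))/2; note α < r + 1. -/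
open Finset

/-- Utility of player `i` in a generalized (set-function) social coordination game:
`U_i(s) = v_i({s_i} ∪ {j ∈ N : s_j = s_i})`, viewing strategies and players as elements
of the disjoint union `N ⊕ M`. -/
def gUtil {N M : Type*} [Fintype N] [DecidableEq N] [DecidableEq M]
    (v : N → Finset (N ⊕ M) → ℝ) (s : N → M) (i : N) : ℝ :=
  v i (insert (Sum.inr (s i)) ((univ.filter (fun j => s j = s i)).image Sum.inl))

/-- The set of players choosing strategy `k` under `s`. -/
def playersAt {N M : Type*} [Fintype N] [DecidableEq M] (s : N → M) (k : M) : Finset N :=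
  univ.filter (fun j => s j = k)

/-- The value to player `i` of playing `k` together with the players of `S`. -/
def coalitionValue {N M : Type*} [DecidableEq N] [DecidableEq M]
    (v : N → Finset (N ⊕ M) → ℝ) (i : N) (k : M) (S : Finset N) : ℝ :=
  v i (insert (Sum.inr k) ((insert i S).image Sum.inl))

/-- Every player outside strategy `m` stays content (up to the factor `α`) with her current
utility, whichever players move from `m` to the strategy she considers deviating to. -/
def RobustOutside {N M : Type*} [Fintype N] [DecidableEq N] [DecidableEq M]
    (v : N → Finset (N ⊕ M) → ℝ) (α : ℝ) (m : M) (s : N → M) : Prop :=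
  ∀ i, s i ≠ m → ∀ k, ∀ T ⊆ playersAt s m,
    coalitionValue v i k (playersAt s k ∪ T) ≤ α * coalitionValue v i (s i) (playersAt s (s i))

section

variable {N M : Type*} [DecidableEq N] [DecidableEq M] {v : N → Finset (N ⊕ M) → ℝ}

lemma coalitionValue_mono (hmono : ∀ i S T, S ⊆ T → v i S ≤ v i T) (i : N) (k : M)
    {S T : Finset N} (h : S ⊆ insert i T) : coalitionValue v i k S ≤ coalitionValue v i k T := by
  refine hmono i _ _ (insert_subset_insert _ (image_subset_image ?_))
  exact insert_subset (mem_insert_self i T) h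

lemma coalitionValue_union_le {r : ℝ} (hsup : ∀ i S T, v i (S ∪ T) ≤ r * (v i S + v i T))
    (i : N) (k : M) (S T : Finset N) :
    coalitionValue v i k (S ∪ T) ≤ r * (coalitionValue v i k S + v i (T.image Sum.inl)) := by
  have h := hsup i (insert (Sum.inr k) ((insert i S).image Sum.inl)) (T.image Sum.inl)
  rwa [insert_union, ← image_union, insert_union] at h

variable [Fintype N]

lemma gUtil_eq_coalitionValue (s : N → M) (i : N) :
    gUtil v s i = coalitionValue v i (s i) (playersAt s (s i)) := by
  have h : i ∈ playersAt s (s i) := by simp [playersAt]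
  rw [coalitionValue, insert_eq_of_mem h, gUtil, playersAt]

lemma playersAt_update_subset (s : N → M) (i : N) (k l : M) :
    playersAt (Function.update s i k) l ⊆ insert i (playersAt s l) := by
  intro j hj
  by_cases hji : j = i <;> simp_all [playersAt]

lemma subset_playersAt_update (s : N → M) (i : N) (k l : M) (h : s i ≠ l) :
    playersAt s l ⊆ playersAt (Function.update s i k) l := by
  intro j hj
  by_cases hji : j = i <;> simp_all [playersAt]

lemma playersAt_update_ssubset (s : N → M) (i : N) {k : M} (h : k ≠ s i) :
    playersAt (Function.update s i k) (s i) ⊂ playersAt s (s i) := by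
  refine (ssubset_iff_of_subset fun j hj => ?_).2 ⟨i, by simp [playersAt], by simp [playersAt, h]⟩
  by_cases hji : j = i <;> simp_all [playersAt]

lemma gUtil_update_eq_coalitionValue (hmono : ∀ i S T, S ⊆ T → v i S ≤ v i T)
    (s : N → M) (i : N) (k : M) :
    gUtil v (Function.update s i k) i = coalitionValue v i k (playersAt s k) := by
  rw [gUtil_eq_coalitionValue, Function.update_self]
  refine le_antisymm (coalitionValue_mono hmono i k (playersAt_update_subset s i k k))
    (coalitionValue_mono hmono i k fun j hj => ?_)
  by_cases hji : j = i <;> simp_all [playersAt]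

/-- Moving a player from `m` to a best response that improves her utility by more than a
factor `α` preserves robustness. -/
lemma RobustOutside.update {r α : ℝ} (hr : 0 ≤ r) (hα : 0 < α) (hα2 : α ^ 2 = r * α + r)
    (hmono : ∀ i S T, S ⊆ T → v i S ≤ v i T)
    (hsup : ∀ i S T, v i (S ∪ T) ≤ r * (v i S + v i T))
    {s : N → M} {i : N} {k : M} (hs : RobustOutside v α (s i) s) (hk : k ≠ s i)
    (hbest : ∀ l, coalitionValue v i l (playersAt s l) ≤ coalitionValue v i k (playersAt s k))
    (himp : α * coalitionValue v i (s i) (playersAt s (s i)) ≤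
      coalitionValue v i k (playersAt s k)) :
    RobustOutside v α (s i) (Function.update s i k) := by
  have hsub := (playersAt_update_ssubset s i hk).subset
  intro j hj l T hT
  have hT' := hT.trans hsub
  by_cases hji : j = i
  · subst hji
    rw [← gUtil_eq_coalitionValue, gUtil_update_eq_coalitionValue hmono]
    have h1 : coalitionValue v j l (playersAt (Function.update s j k) l ∪ T) ≤
        coalitionValue v j l (playersAt s l ∪ T) := by
      refine coalitionValue_mono hmono j l (union_subset ?_ ?_)
      · exact (playersAt_update_subset s j k l).trans
          (insert_subset_insert _ subset_union_left)
      · exact subset_union_right.trans (subset_insert _ _)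
    have h2 := coalitionValue_union_le hsup j l (playersAt s l) T
    have h3 : v j (T.image Sum.inl) ≤ coalitionValue v j (s j) (playersAt s (s j)) :=
      hmono j _ _ ((image_subset_image (hT'.trans (subset_insert _ _))).trans (subset_insert _ _))
    set u := coalitionValue v j k (playersAt s k)
    have h4 : α * v j (T.image Sum.inl) ≤ u := (mul_le_mul_of_nonneg_left h3 hα.le).trans himp
    have h5 : r * (α * (coalitionValue v j l (playersAt s l) + v j (T.image Sum.inl))) ≤
        r * (α * u + u) := by
      refine mul_le_mul_of_nonneg_left ?_ hr
      linarith [mul_le_mul_of_nonneg_left (hbest l) hα.le]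
    refine le_of_mul_le_mul_left ?_ hα
    calc _ ≤ α * (r * (coalitionValue v j l (playersAt s l) + v j (T.image Sum.inl))) :=
          mul_le_mul_of_nonneg_left (h1.trans h2) hα.le
      _ ≤ r * (α * u + u) := by linarith
      _ = α * (α * u) := by linear_combination (-u) * hα2
  · rw [Function.update_of_ne hji] at hj ⊢
    have hi : {i} ⊆ playersAt s (s i) := by simp [playersAt]
    have h1 := hs j hj l ({i} ∪ T) (union_subset hi hT')
    have h2 : playersAt (Function.update s i k) l ∪ T ⊆ playersAt s l ∪ ({i} ∪ T) := by
      have := playersAt_update_subset s i k l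
      grind
    refine (coalitionValue_mono hmono j l (h2.trans (subset_insert _ _))).trans (h1.trans ?_)
    refine mul_le_mul_of_nonneg_left (coalitionValue_mono hmono j (s j) ?_) hα.le
    exact (subset_playersAt_update s i k (s j) (Ne.symm hj)).trans (subset_insert _ _)

lemma RobustOutside.exists_approx_equilibrium [Fintype M] {r α : ℝ} (hr : 0 ≤ r) (hα : 1 ≤ α)
    (hα2 : α ^ 2 = r * α + r) (hnonneg : ∀ i S, 0 ≤ v i S)
    (hmono : ∀ i S T, S ⊆ T → v i S ≤ v i T)
    (hsup : ∀ i S T, v i (S ∪ T) ≤ r * (v i S + v i T))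
    (m : M) (s : N → M) (hs : RobustOutside v α m s) :
    ∃ s : N → M, ∀ i k, gUtil v (Function.update s i k) i ≤ α * gUtil v s i := by
  by_cases h : ∀ i, s i = m → ∀ k, gUtil v (Function.update s i k) i ≤ α * gUtil v s i
  · refine ⟨s, fun i k => ?_⟩
    by_cases hi : s i = m
    · exact h i hi k
    · have := hs i hi k ∅ (empty_subset _)
      rwa [union_empty, ← gUtil_update_eq_coalitionValue hmono, ← gUtil_eq_coalitionValue] at this
  · push Not at h
    obtain ⟨i, rfl, l, hl⟩ := h
    rw [gUtil_update_eq_coalitionValue hmono, gUtil_eq_coalitionValue] at hl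
    obtain ⟨k, -, hk⟩ := exists_max_image univ
      (fun k => coalitionValue v i k (playersAt s k)) ⟨l, mem_univ l⟩
    have hbest := fun l => hk l (mem_univ l)
    have himp := hl.trans_le (hbest l)
    have hki : k ≠ s i := by
      rintro rfl
      exact himp.not_ge (le_mul_of_one_le_left (hnonneg _ _) hα)
    have hcard := card_lt_card (playersAt_update_ssubset s i hki)
    exact RobustOutside.exists_approx_equilibrium hr hα hα2 hnonneg hmono hsup (s i) _
      (hs.update hr (by linarith) hα2 hmono hsup hki hbest himp.le)
termination_by (playersAt s m).card
decreasing_by simp_all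

end

/-- Social coordination with bounded supermodularity: if every `v_i` is nonnegative,
monotone, and `r`-supermodular (`v_i(S ∪ T) ≤ r·(v_i(S) + v_i(T))`) for some `r ≥ 1`,
then the game admits an `α`-approximate equilibrium with `α = (r + √(r² + 4r))/2`;
moreover `α < r + 1`. -/
theorem bounded_supermodular_approx
    {N M : Type*} [Fintype N] [DecidableEq N] [Nonempty N]
    [Fintype M] [DecidableEq M] [Nonempty M]
    (v : N → Finset (N ⊕ M) → ℝ) (r : ℝ) (hr : 1 ≤ r)
    (hnonneg : ∀ i S, 0 ≤ v i S)
    (hmono : ∀ i S T, S ⊆ T → v i S ≤ v i T)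
    (hsup : ∀ i S T, v i (S ∪ T) ≤ r * (v i S + v i T)) :
    (∃ s : N → M, ∀ (i : N) (k : M),
      gUtil v (Function.update s i k) i ≤ ((r + Real.sqrt (r ^ 2 + 4 * r)) / 2) * gUtil v s i) ∧
    (r + Real.sqrt (r ^ 2 + 4 * r)) / 2 < r + 1 := by
  have hsq : Real.sqrt (r ^ 2 + 4 * r) ^ 2 = r ^ 2 + 4 * r := Real.sq_sqrt (by positivity)
  have hle : r ≤ Real.sqrt (r ^ 2 + 4 * r) := Real.le_sqrt_of_sq_le (by linarith)
  have hlt : Real.sqrt (r ^ 2 + 4 * r) < r + 2 :=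
    (Real.sqrt_lt' (by linarith)).2 (by linarith [sq_nonneg r, add_sq r 2])
  refine ⟨?_, by linarith⟩
  let m : M := Classical.arbitrary M
  refine RobustOutside.exists_approx_equilibrium (r := r) (by linarith) (by linarith) ?_
    hnonneg hmono hsup m (fun _ => m) (fun i hi => absurd rfl hi)
  linear_combination hsq / 4
end
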